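/- Let α, β, β̂ : ℝ → ℝ be locally integrable and γ-periodic for a common period γ > 0, and assume (−1)^m·β(t) ≥ (−1)^m·β̂(t) ≥ 0 for almost every t, for some integer m. Let (λ_k)_{k≥1} and (λ̂_k)_{k≥1} be ordered enumerations of the Floquet multipliers of x'(t) = −α(t)x(t) − β(t)x(t−1) and of x'(t) = −α(t)x(t) − β̂(t)x(t−1), respectively, with the convention that the sequence is extended by zeros if there are only finitely many Floquet multipliers counted with multiplicity. Then |λ_1·λ_2⋯λ_k| ≥ |λ̂_1·λ̂_2⋯λ̂_k| for every k ≥ 1 such that k − m is even. -/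

import Mathlib

open MeasureTheory

noncomputable section

abbrev I01 : Set ℝ := Set.Icc (-1 : ℝ) 0

abbrev CC := C(I01, ℂ)

/-- A complex-valued solution of `x'(t) = -α(t) x(t) - β(t) x(t-1)` on `[τ-1, T]`. -/
def IsSolutionC (a c : ℝ → ℝ) (τ T : ℝ) (x : ℝ → ℂ) : Prop :=
  ContinuousOn x (Set.Icc (τ - 1) T) ∧
  ∀ t ∈ Set.Icc τ T, x t = x τ - ∫ s in τ..t, ((a s : ℂ) * x s + (c s : ℂ) * x (s - 1))

/-- `M` is the monodromy operator of the `γ`-periodic delay equation. -/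
def IsMonodromy (a c : ℝ → ℝ) (γ : ℝ) (M : CC →L[ℂ] CC) : Prop :=
  ∀ (φ : CC) (x : ℝ → ℂ), IsSolutionC a c 0 γ x →
    (∀ θ : I01, x (θ : ℝ) = φ θ) → ∀ θ : I01, M φ θ = x (γ + (θ : ℝ))

/-- A Floquet multiplier: a nonzero eigenvalue of the monodromy operator. -/
def IsFloquetMult (M : CC →L[ℂ] CC) (μ : ℂ) : Prop :=
  μ ≠ 0 ∧ ∃ φ : CC, φ ≠ 0 ∧ M φ = μ • φ

/-- The generalized eigenspace `G_μ = ⋃ₙ ker (M - μ I)^n`. -/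
def genEig (M : CC →L[ℂ] CC) (μ : ℂ) : Submodule ℂ CC :=
  ⨆ n : ℕ, LinearMap.ker (((M - μ • (1 : CC →L[ℂ] CC)) ^ n : CC →L[ℂ] CC) : CC →ₗ[ℂ] CC)

/-- The algebraic multiplicity of `μ`. -/
def algMult (M : CC →L[ℂ] CC) (μ : ℂ) : ℕ :=
  Module.finrank ℂ (genEig M μ)

/-- An ordered enumeration `(Λ k)_{k ≥ 1}` of the Floquet multipliers with repetitions
according to algebraic multiplicity, extended by zeros if there are only finitely many. -/
def IsOrderedEnumExt (M : CC →L[ℂ] CC) (Λ : ℕ → ℂ) : Prop :=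
  (∀ k : ℕ, 1 ≤ k → ‖Λ (k + 1)‖ ≤ ‖Λ k‖) ∧
  (∀ k : ℕ, 1 ≤ k → Λ k = 0 ∨ IsFloquetMult M (Λ k)) ∧
  (∀ μ : ℂ, IsFloquetMult M μ → Nat.card {k : ℕ | 1 ≤ k ∧ Λ k = μ} = algMult M μ)

section RootFlag

open Module

variable {K V : Type*} [Field K] [AddCommGroup V] [Module K V]

/-- The span of the first `i` vectors of a sequence. -/
def flagSpan (K : Type*) {V : Type*} [Field K] [AddCommGroup V] [Module K V]
    (φ : ℕ → V) (i : ℕ) : Submodule K V :=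
  Submodule.span K (φ '' Set.Iio i)

/-- The first `N` vectors of `φ` are linearly independent root vectors of `f`, the `i`-th one for
the eigenvalue `Λ i`, in which `f` is triangular. -/
def IsRootFlag (f : End K V) (Λ : ℕ → K) (φ : ℕ → V) (N : ℕ) : Prop :=
  ∀ i < N, φ i ∈ f.maxGenEigenspace (Λ i) ∧ f (φ i) - Λ i • φ i ∈ flagSpan K φ i ∧
    φ i ∉ flagSpan K φ i

lemma flagSpan_mono (φ : ℕ → V) : Monotone (flagSpan K φ) := fun _ _ h =>
  Submodule.span_mono (Set.image_mono (Set.Iio_subset_Iio h))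

lemma mem_flagSpan {φ : ℕ → V} {i j : ℕ} (h : j < i) : φ j ∈ flagSpan K φ i :=
  Submodule.subset_span ⟨j, h, rfl⟩

lemma exists_sub_smul_mem_flagSpan {φ : ℕ → V} {i : ℕ} {x : V} (hx : x ∈ flagSpan K φ (i + 1)) :
    ∃ c : K, x - c • φ i ∈ flagSpan K φ i := by
  have h : Set.Iio (i + 1) = insert i (Set.Iio i) := by ext j; simp
  rw [flagSpan, h, Set.image_insert_eq, Submodule.mem_span_insert] at hx
  obtain ⟨c, z, hz, rfl⟩ := hx
  exact ⟨c, by simpa [flagSpan] using hz⟩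

lemma flagSpan_congr {φ ψ : ℕ → V} {i : ℕ} (h : ∀ j < i, φ j = ψ j) :
    flagSpan K φ i = flagSpan K ψ i := by
  exact congrArg _ (Set.image_congr fun j hj => h j hj)

instance (φ : ℕ → V) (i : ℕ) : FiniteDimensional K (flagSpan K φ i) :=
  FiniteDimensional.span_of_finite K ((Set.finite_Iio i).image φ)

variable {f : End K V} {Λ : ℕ → K} {φ : ℕ → V} {N : ℕ}

lemma IsRootFlag.mono (h : IsRootFlag f Λ φ N) {i : ℕ} (hi : i ≤ N) : IsRootFlag f Λ φ i :=
  fun j hj => h j (hj.trans_le hi)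

lemma IsRootFlag.map_mem (h : IsRootFlag f Λ φ N) {x : V} (hx : x ∈ flagSpan K φ N) :
    f x ∈ flagSpan K φ N := by
  have : flagSpan K φ N ≤ (flagSpan K φ N).comap f := by
    refine Submodule.span_le.2 ?_
    rintro _ ⟨j, hj, rfl⟩
    have h2 := flagSpan_mono (K := K) φ (le_of_lt hj) (h j hj).2.1
    have := Submodule.add_mem _ h2 (Submodule.smul_mem _ (Λ j) (mem_flagSpan (K := K) (φ := φ) hj))
    simpa using this
  exact this hx

/-- If `f` acts on `x` as multiplication by `ν` modulo an invariant subspace, so does every power of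
`f - μ`, with `ν - μ` in place of `ν`. -/
lemma pow_sub_smul_mem {f : End K V} {E : Submodule K V} (hE : ∀ x ∈ E, f x ∈ E) {x : V} {μ ν : K}
    (hx : f x - ν • x ∈ E) (n : ℕ) : ((f - μ • 1) ^ n) x - (ν - μ) ^ n • x ∈ E := by
  induction n with
  | zero => simp
  | succ n ih =>
    have h1 : (f - μ • 1) (((f - μ • 1) ^ n) x - (ν - μ) ^ n • x) ∈ E :=
      E.sub_mem (hE _ ih) (E.smul_mem μ ih)
    have h2 := E.smul_mem ((ν - μ) ^ n) hx
    have h3 := E.add_mem h1 h2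
    convert h3 using 1
    rw [pow_succ', Module.End.mul_apply]
    simp only [map_sub, map_smul, LinearMap.sub_apply, LinearMap.smul_apply, Module.End.one_apply]
    module

lemma exists_mem_maxGenEigenspace_notMem {f : End K V} {E : Submodule K V}
    {μ : K} (h : ¬ f.maxGenEigenspace μ ≤ E) :
    ∃ x ∈ f.maxGenEigenspace μ, x ∉ E ∧ f x - μ • x ∈ E := by
  obtain ⟨x, hx, hxE⟩ := SetLike.not_le_iff_exists.1 h
  have hex : ∃ n, ((f - μ • (1 : End K V)) ^ n) x ∈ E := by
    obtain ⟨n, hn⟩ := (f.mem_maxGenEigenspace μ x).1 hx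
    exact ⟨n, by simp [hn]⟩
  classical
  have h0 : Nat.find hex ≠ 0 := by
    intro h0
    have := Nat.find_spec hex
    rw [h0] at this
    exact hxE (by simpa using this)
  obtain ⟨m, hm⟩ := Nat.exists_eq_succ_of_ne_zero h0
  refine ⟨((f - μ • (1 : End K V)) ^ m) x, ?_, Nat.find_min hex (by omega), ?_⟩
  · obtain ⟨n, hn⟩ := (f.mem_maxGenEigenspace μ x).1 hx
    refine (f.mem_maxGenEigenspace μ _).2 ⟨n, ?_⟩
    rw [← Module.End.mul_apply, ← pow_add, add_comm, pow_add, Module.End.mul_apply, hn, map_zero]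
  · have := Nat.find_spec hex
    rw [hm, Nat.succ_eq_add_one, pow_succ', Module.End.mul_apply] at this
    simpa using this

/-- A root vector in the span of a root flag is a combination of the flag vectors with the same
eigenvalue. -/
lemma IsRootFlag.maxGenEigenspace_inf_le (h : IsRootFlag f Λ φ N) (μ : K) :
    f.maxGenEigenspace μ ⊓ flagSpan K φ N ≤ Submodule.span K (φ '' {j | j < N ∧ Λ j = μ}) := by
  induction N with
  | zero =>
    rintro x ⟨-, hx⟩
    have : x = 0 := by simpa [flagSpan] using hx
    simp [this]
  | succ N ih =>
    rintro x ⟨hx, hxN⟩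
    have hN := h.mono N.le_succ
    have hmono : Submodule.span K (φ '' {j | j < N ∧ Λ j = μ}) ≤
        Submodule.span K (φ '' {j | j < N + 1 ∧ Λ j = μ}) :=
      Submodule.span_mono (Set.image_mono fun j hj => ⟨hj.1.trans N.lt_succ_self, hj.2⟩)
    obtain ⟨c, hc⟩ := exists_sub_smul_mem_flagSpan hxN
    obtain ⟨h1, h2, h3⟩ := h N N.lt_succ_self
    by_cases hΛ : Λ N = μ
    · have hφ : φ N ∈ f.maxGenEigenspace μ := hΛ ▸ h1
      have := hmono (ih hN ⟨Submodule.sub_mem _ hx (Submodule.smul_mem _ c hφ), hc⟩)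
      have h4 : φ N ∈ Submodule.span K (φ '' {j | j < N + 1 ∧ Λ j = μ}) :=
        Submodule.subset_span ⟨N, ⟨N.lt_succ_self, hΛ⟩, rfl⟩
      simpa using Submodule.add_mem _ this (Submodule.smul_mem _ c h4)
    · refine hmono (ih hN ⟨hx, ?_⟩)
      obtain ⟨n, hn⟩ := (f.mem_maxGenEigenspace μ x).1 hx
      set E := flagSpan K φ N
      have hE : ∀ x ∈ E, f x ∈ E := fun x hx => hN.map_mem hx
      have e1 := pow_sub_smul_mem (μ := μ) hE h2 n
      have e2 : ((f - μ • 1) ^ n) (x - c • φ N) ∈ E := by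
        have : ∀ m, ∀ y ∈ E, ((f - μ • (1 : End K V)) ^ m) y ∈ E := by
          intro m
          induction m with
          | zero => simp
          | succ m ihm =>
            intro y hy
            rw [pow_succ', Module.End.mul_apply]
            exact E.sub_mem (hE _ (ihm y hy)) (E.smul_mem μ (ihm y hy))
        exact this n _ hc
      have e3 : (c * (Λ N - μ) ^ n) • φ N ∈ E := by
        have := E.neg_mem (E.add_mem e2 (E.smul_mem c e1))
        convert this using 1
        rw [map_sub, hn, map_smul]
        module
      by_cases hc0 : c = 0
      · simpa [hc0] using hc
      · have hne : c * (Λ N - μ) ^ n ≠ 0 := mul_ne_zero hc0 (pow_ne_zero _ (sub_ne_zero.2 hΛ))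
        exact absurd ((Submodule.smul_mem_iff _ hne).1 e3) h3

lemma IsRootFlag.linearIndependent (h : IsRootFlag f Λ φ N) :
    LinearIndependent K (fun i : Fin N => φ i) := by
  induction N with
  | zero => exact linearIndependent_empty_type
  | succ N ih =>
    have h1 : (fun i : Fin (N + 1) => φ i) = Fin.snoc (fun i : Fin N => φ i) (φ N) := by
      ext i
      refine Fin.lastCases ?_ (fun i => ?_) i <;> simp
    rw [h1, linearIndependent_finSnoc]
    refine ⟨ih (h.mono N.le_succ), ?_⟩
    convert (h N N.lt_succ_self).2.2 using 2
    rw [flagSpan]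
    congr 1
    ext y
    simp only [Set.mem_range, Set.mem_image, Set.mem_Iio]
    exact ⟨fun ⟨i, hi⟩ => ⟨i, i.2, hi⟩, fun ⟨i, hi, hy⟩ => ⟨⟨i, hi⟩, hy⟩⟩

/-- A root flag contains a whole generalized eigenspace once its eigenvalue occurs often enough. -/
lemma IsRootFlag.maxGenEigenspace_le (h : IsRootFlag f Λ φ N) {μ : K}
    [FiniteDimensional K (f.maxGenEigenspace μ)]
    (hμ : finrank K (f.maxGenEigenspace μ) ≤ Nat.card {j // j < N ∧ Λ j = μ}) :
    f.maxGenEigenspace μ ≤ flagSpan K φ N := by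
  set s := {j | j < N ∧ Λ j = μ} with hs
  have hfin : Finite s := (Set.finite_Iio N).subset (fun j hj => hj.1)
  have : Fintype s := Fintype.ofFinite s
  have hli : LinearIndependent K (fun j : s => φ j) :=
    h.linearIndependent.comp (fun j : s => (⟨j, j.2.1⟩ : Fin N))
      (fun a b hab => Subtype.ext (by simpa using hab))
  have hle : Submodule.span K (Set.range fun j : s => φ j) ≤ f.maxGenEigenspace μ := by
    refine Submodule.span_le.2 ?_
    rintro _ ⟨j, rfl⟩
    have := (h j j.2.1).1
    rwa [j.2.2] at this
  have heq := Submodule.eq_of_le_of_finrank_le hle (by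
    rw [finrank_span_eq_card hli]
    rw [← Nat.card_eq_fintype_card]; exact hμ)
  rw [← heq]
  refine Submodule.span_le.2 ?_
  rintro _ ⟨j, rfl⟩
  exact mem_flagSpan j.2.1

lemma exists_isRootFlag (f : End K V) (Λ : ℕ → K) (N : ℕ)
    (hΛ : ∀ i < N, Nat.card {j // j < i ∧ Λ j = Λ i} < finrank K (f.maxGenEigenspace (Λ i))) :
    ∃ φ, IsRootFlag f Λ φ N := by
  induction N with
  | zero => exact ⟨0, fun i hi => absurd hi (Nat.not_lt_zero i)⟩
  | succ N ih =>
    obtain ⟨φ, hφ⟩ := ih fun i hi => hΛ i (hi.trans N.lt_succ_self)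
    have hnot : ¬ f.maxGenEigenspace (Λ N) ≤ flagSpan K φ N := by
      intro hle
      have h1 := hφ.maxGenEigenspace_inf_le (Λ N)
      rw [inf_eq_left.2 hle] at h1
      set s := {j | j < N ∧ Λ j = Λ N} with hs
      have hfin : s.Finite := (Set.finite_Iio N).subset (fun j hj => hj.1)
      have := FiniteDimensional.span_of_finite K (hfin.image φ)
      have h2 := Submodule.finrank_mono h1
      classical
      have h3 : finrank K (Submodule.span K (φ '' s)) ≤ Nat.card s := by
        have := finrank_span_finset_le_card (R := K) (hfin.toFinset.image φ)
        rw [Set.finrank, Finset.coe_image, Set.Finite.coe_toFinset] at this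
        refine this.trans (Finset.card_image_le.trans ?_)
        rw [Nat.card_coe_set_eq, Set.ncard_eq_toFinset_card s hfin]
      exact absurd (hΛ N N.lt_succ_self) (not_lt.2 (h2.trans h3))
    obtain ⟨x, hx, hxE, hfx⟩ := exists_mem_maxGenEigenspace_notMem hnot
    refine ⟨Function.update φ N x, fun i hi => ?_⟩
    have hcongr : ∀ i ≤ N, flagSpan K (Function.update φ N x) i = flagSpan K φ i := fun i hi =>
      flagSpan_congr fun j hj => Function.update_of_ne (by omega) _ _
    rcases Nat.lt_succ_iff_lt_or_eq.1 hi with hi | rfl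
    · rw [hcongr i hi.le, Function.update_of_ne hi.ne]
      exact hφ i hi
    · rw [hcongr i le_rfl, Function.update_self]
      exact ⟨hx, hfx, hxE⟩

/-- If `f` acts on `x` as multiplication by `μ` modulo a finite-dimensional invariant subspace that
contains all root vectors for `μ`, then `x` lies in that subspace. -/
lemma mem_of_sub_smul_mem {f : End K V} {E : Submodule K V} [FiniteDimensional K E]
    (hE : ∀ x ∈ E, f x ∈ E) {μ : K} (hμ : f.maxGenEigenspace μ ≤ E) {x : V}
    (hx : f x - μ • x ∈ E) : x ∈ E := by
  set S : End K V := f - μ • 1 with hS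
  have hSE : ∀ x ∈ E, S x ∈ E := fun x hx => E.sub_mem (hE x hx) (E.smul_mem μ hx)
  set R : End K E := S.restrict hSE with hR
  obtain ⟨n, hn⟩ := IsArtinian.monotone_stabilizes R.iterateRange
  have hrange : LinearMap.range (R ^ n) = LinearMap.range (R ^ (n + 1)) := hn (n + 1) n.le_succ
  have hpow : ∀ m (y : E), ((R ^ m) y : V) = (S ^ m) y := by
    intro m y
    rw [hR, Module.End.pow_restrict]
    rfl
  have hmem : (R ^ n) ⟨S x, hx⟩ ∈ LinearMap.range (R ^ (n + 1)) := hrange ▸ ⟨_, rfl⟩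
  obtain ⟨e, he⟩ := hmem
  have he' := congrArg Subtype.val he
  rw [hpow, hpow] at he'
  have hxe : x - e ∈ f.maxGenEigenspace μ := by
    refine (f.mem_maxGenEigenspace μ _).2 ⟨n + 1, ?_⟩
    rw [map_sub, ← hS, he', pow_succ, Module.End.mul_apply, sub_self]
  simpa using E.add_mem (hμ hxe) e.2

lemma exists_hasEigenvalue_of_aeval_eq_zero {K V : Type*} [Field K] [IsAlgClosed K]
    [AddCommGroup V] [Module K V] (f : End K V) :
    ∀ (n : ℕ) (q : Polynomial K), q.natDegree = n → q ≠ 0 → ∀ v : V, v ≠ 0 →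
      Polynomial.aeval f q v = 0 → ∃ ν, q.IsRoot ν ∧ f.HasEigenvalue ν := by
  intro n
  induction n with
  | zero =>
    intro q hq hq0 v hv h
    rw [Polynomial.eq_C_of_natDegree_eq_zero hq] at h hq0
    have : q.coeff 0 = 0 := by
      simpa [Polynomial.aeval_C, Module.algebraMap_end_apply, hv] using h
    simp [this] at hq0
  | succ n ih =>
    intro q hq hq0 v hv h
    obtain ⟨ν, hν⟩ := IsAlgClosed.exists_root q (by
      rw [Polynomial.degree_eq_natDegree hq0, hq]; exact_mod_cast n.succ_ne_zero)
    obtain ⟨g, rfl⟩ := Polynomial.dvd_iff_isRoot.2 hν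
    have hg0 : g ≠ 0 := right_ne_zero_of_mul hq0
    by_cases hw : Polynomial.aeval f g v = 0
    · rw [Polynomial.natDegree_mul (left_ne_zero_of_mul hq0) hg0, Polynomial.natDegree_X_sub_C] at hq
      obtain ⟨ν', h1, h2⟩ := ih g (by omega) hg0 v hv hw
      exact ⟨ν', by simp [Polynomial.IsRoot.def, h1.eq_zero], h2⟩
    · refine ⟨ν, hν, End.hasEigenvalue_of_hasEigenvector (x := Polynomial.aeval f g v) ⟨?_, hw⟩⟩
      rw [End.mem_eigenspace_iff]
      rw [map_mul, Module.End.mul_apply] at h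
      simpa [sub_eq_zero, Module.algebraMap_end_apply] using h

end RootFlag

section CompactPower

open Module Filter Topology

variable {X : Type*} [NormedAddCommGroup X] [NormedSpace ℂ X]

lemma exists_hasEigenvalue_norm_eq [CompleteSpace X] {T : X →L[ℂ] X} {p : ℕ} (hp : p ≠ 0)
    (hT : IsCompactOperator (T ^ p : X →L[ℂ] X)) {μ : ℂ} (hμ : μ ∈ spectrum ℂ T) (hμ0 : μ ≠ 0) :
    ∃ ν, End.HasEigenvalue (T : X →ₗ[ℂ] X) ν ∧ ‖ν‖ = ‖μ‖ := by
  have h1 : μ ^ p ∈ spectrum ℂ (T ^ p) := spectrum.pow_mem_pow T p hμ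
  rw [← hT.hasEigenvalue_iff_mem_spectrum (pow_ne_zero p hμ0)] at h1
  obtain ⟨v, hv⟩ := h1.exists_hasEigenvector
  obtain ⟨ν, hν, hev⟩ := exists_hasEigenvalue_of_aeval_eq_zero (T : End ℂ X) _
    (Polynomial.X ^ p - Polynomial.C (μ ^ p)) rfl (Polynomial.X_pow_sub_C_ne_zero
      (Nat.pos_of_ne_zero hp) _) v hv.2 (by
      have := hv.apply_eq_smul
      rw [ContinuousLinearMap.toLinearMap_pow] at this
      simp only [map_sub, map_pow, Polynomial.aeval_X, Polynomial.aeval_C, LinearMap.sub_apply]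
      rw [this, ← map_pow, Module.algebraMap_end_apply, sub_self])
  refine ⟨ν, hev, ?_⟩
  have : ν ^ p = μ ^ p := by simpa [Polynomial.IsRoot.def, sub_eq_zero] using hν
  have h3 := congrArg norm this
  rw [norm_pow, norm_pow] at h3
  exact (pow_left_inj₀ (norm_nonneg _) (norm_nonneg _) hp).1 h3

lemma exists_norm_pow_le [CompleteSpace X] {T : X →L[ℂ] X} {p : ℕ} (hp : p ≠ 0)
    (hT : IsCompactOperator (T ^ p : X →L[ℂ] X)) {r ρ : ℝ} (hr : 0 ≤ r) (hρ : r < ρ)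
    (h : ∀ μ ≠ 0, End.HasEigenvalue (T : X →ₗ[ℂ] X) μ → ‖μ‖ ≤ r) :
    ∃ C, 0 ≤ C ∧ ∀ n, ‖T ^ n‖ ≤ C * ρ ^ n := by
  have hρ0 : 0 < ρ := hr.trans_lt hρ
  have hsr : spectralRadius ℂ T < ENNReal.ofReal ρ := by
    refine lt_of_le_of_lt (b := ENNReal.ofReal r) (iSup₂_le fun μ hμ => ?_)
      ((ENNReal.ofReal_lt_ofReal_iff hρ0).2 hρ)
    change ‖μ‖ₑ ≤ _
    rw [← ofReal_norm]
    refine ENNReal.ofReal_le_ofReal ?_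
    by_cases hμ0 : μ = 0
    · simpa [hμ0] using hr
    · obtain ⟨ν, hν, hn⟩ := exists_hasEigenvalue_norm_eq hp hT hμ hμ0
      rw [← hn]
      exact h ν (by rw [← norm_ne_zero_iff, hn]; simpa using hμ0) hν
  have hev := (spectrum.pow_norm_pow_one_div_tendsto_nhds_spectralRadius T).eventually
    (gt_mem_nhds hsr)
  obtain ⟨n₀, hn₀⟩ := eventually_atTop.1 hev
  refine ⟨1 + ∑ n ∈ Finset.range (n₀ + 1), ‖T ^ n‖ / ρ ^ n, by positivity, fun n => ?_⟩
  have hpos : ∀ n ∈ Finset.range (n₀ + 1), 0 ≤ ‖T ^ n‖ / ρ ^ n := fun n _ => by positivity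
  rw [← div_le_iff₀ (by positivity)]
  by_cases hn : n ∈ Finset.range (n₀ + 1)
  · have := Finset.single_le_sum hpos hn
    linarith
  · have hn' : n₀ < n := by simpa using hn
    have h1 := hn₀ n hn'.le
    rw [ENNReal.ofReal_lt_ofReal_iff hρ0] at h1
    have hne : (n : ℝ) ≠ 0 := Nat.cast_ne_zero.2 (by omega)
    have h2 : ‖T ^ n‖ ≤ ρ ^ n := by
      have := pow_le_pow_left₀ (by positivity) h1.le n
      rwa [← Real.rpow_natCast, ← Real.rpow_mul (norm_nonneg _), one_div, inv_mul_cancel₀ hne,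
        Real.rpow_one] at this
    have h3 : ‖T ^ n‖ / ρ ^ n ≤ 1 := by rw [div_le_one (by positivity)]; exact h2
    have := Finset.sum_nonneg hpos
    linarith

/-- A Riesz vector for the extension of a finite-dimensional invariant subspace by a root vector. -/
lemma exists_riesz_vector {f : End ℂ X} {E : Submodule ℂ X} [FiniteDimensional ℂ E]
    (hE : ∀ x ∈ E, f x ∈ E) {μ : ℂ} (h : ¬ f.maxGenEigenspace μ ≤ E) :
    ∃ u, ‖u‖ ≤ 3 ∧ (∀ y ∈ E, 1 ≤ ‖u - y‖) ∧ f u - μ • u ∈ E := by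
  obtain ⟨x, -, hxE, hx⟩ := exists_mem_maxGenEigenspace_notMem h
  set E' : Submodule ℂ X := E ⊔ Submodule.span ℂ {x}
  have hcl : IsClosed ((E.comap E'.subtype : Submodule ℂ E') : Set E') :=
    (Submodule.closed_of_finiteDimensional E).preimage continuous_subtype_val
  have hxE' : x ∈ E' := Submodule.mem_sup_right (Submodule.mem_span_singleton_self x)
  obtain ⟨u, hu, hdist⟩ := riesz_lemma_of_norm_lt (𝕜 := ℂ) (c := 2) (R := 3) (by simp) (by norm_num)
    hcl ⟨⟨x, hxE'⟩, hxE⟩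
  refine ⟨u, hu, fun y hy => hdist ⟨y, Submodule.mem_sup_left hy⟩ hy, ?_⟩
  obtain ⟨e, he, z, hz, hez⟩ := Submodule.mem_sup.1 u.2
  obtain ⟨c, rfl⟩ := Submodule.mem_span_singleton.1 hz
  rw [← hez]
  have h1 := E.add_mem (E.sub_mem (hE e he) (E.smul_mem μ he)) (E.smul_mem c hx)
  convert h1 using 1
  simp only [map_add, map_smul]
  module

lemma finiteDimensional_maxGenEigenspace {T : X →L[ℂ] X} {p : ℕ}
    (hT : IsCompactOperator (T ^ p : X →L[ℂ] X)) {μ : ℂ} (hμ : μ ≠ 0) :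
    FiniteDimensional ℂ (End.maxGenEigenspace (T : X →ₗ[ℂ] X) μ) := by
  by_contra hinf
  set f : End ℂ X := (T : End ℂ X) with hf
  let S := {E : Submodule ℂ X // FiniteDimensional ℂ E ∧ ∀ x ∈ E, f x ∈ E}
  have hstep : ∀ E : S, ∃ u : X, ∃ E' : S, E.1 ≤ E'.1 ∧ u ∈ E'.1 ∧ ‖u‖ ≤ 3 ∧
      (∀ y ∈ E.1, 1 ≤ ‖u - y‖) ∧ f u - μ • u ∈ E.1 := by
    rintro ⟨E, hfin, hE⟩
    obtain ⟨u, h1, h2, h3⟩ := exists_riesz_vector (f := f) hE (μ := μ) fun hle =>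
      hinf (Submodule.finiteDimensional_of_le hle)
    refine ⟨u, ⟨E ⊔ Submodule.span ℂ {u}, inferInstance, ?_⟩, le_sup_left,
      Submodule.mem_sup_right (Submodule.mem_span_singleton_self u), h1, h2, h3⟩
    intro x hx
    obtain ⟨e, he, z, hz, rfl⟩ := Submodule.mem_sup.1 hx
    obtain ⟨c, rfl⟩ := Submodule.mem_span_singleton.1 hz
    have h5 : f (e + c • u) = (f e + c • (f u - μ • u)) + (c * μ) • u := by
      simp only [map_add, map_smul]
      module
    rw [h5]
    exact Submodule.add_mem_sup (E.add_mem (hE e he) (E.smul_mem c h3))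
      (Submodule.smul_mem _ _ (Submodule.mem_span_singleton_self u))
  choose u nx hle hmem hnorm hdist hroot using hstep
  let E : ℕ → S := fun n => nx^[n] ⟨⊥, inferInstance, by simp⟩
  have hEs : ∀ n, E (n + 1) = nx (E n) := fun n => Function.iterate_succ_apply' _ _ _
  have hEmono : Monotone fun n => (E n).1 := monotone_nat_of_le_succ fun n => by
    rw [hEs]; exact hle _
  obtain ⟨K, hK, hKsub⟩ := hT.image_closedBall_subset_compact 3
  have hin : ∀ n, (T ^ p) (u (E n)) ∈ K := fun n => hKsub ⟨_, by simpa using hnorm (E n), rfl⟩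
  obtain ⟨a, -, φ, hφ, hlim⟩ := hK.tendsto_subseq hin
  have hpow : ∀ x, (T ^ p) x = (f ^ p) x := fun x => by
    rw [hf, ← ContinuousLinearMap.toLinearMap_pow]; rfl
  have hsep : ∀ m n, m < n → ‖μ‖ ^ p ≤ dist ((T ^ p) (u (E n))) ((T ^ p) (u (E m))) := by
    intro m n hmn
    have h1 := pow_sub_smul_mem (μ := 0) (E n).2.2 (hroot (E n)) p
    rw [zero_smul, sub_zero, sub_zero] at h1
    have h2 : (f ^ p) (u (E m)) ∈ (E n).1 := by
      have h3 : u (E m) ∈ (E n).1 := hEmono (show m + 1 ≤ n from hmn) (by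
        simp only [hEs]; exact hmem _)
      clear hlim
      induction p with
      | zero => simpa using h3
      | succ q _ =>
        have : ∀ q, (f ^ q) (u (E m)) ∈ (E n).1 := by
          intro q
          induction q with
          | zero => simpa using h3
          | succ q ih => rw [pow_succ', Module.End.mul_apply]; exact (E n).2.2 _ ih
        exact this _
    have h4 := hdist (E n) _ ((E n).1.smul_mem (μ ^ p)⁻¹ ((E n).1.sub_mem h2 h1))
    rw [dist_eq_norm, hpow, hpow]
    have hμp : μ ^ p ≠ 0 := pow_ne_zero _ hμ
    have h5 : (f ^ p) (u (E n)) - (f ^ p) (u (E m)) = μ ^ p • (u (E n) - (μ ^ p)⁻¹ •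
        ((f ^ p) (u (E m)) - ((f ^ p) (u (E n)) - μ ^ p • u (E n)))) := by
      rw [smul_sub, smul_smul, mul_inv_cancel₀ hμp]
      module
    rw [h5, norm_smul, norm_pow]
    exact le_mul_of_one_le_right (by positivity) h4
  obtain ⟨N, hN⟩ := Metric.cauchySeq_iff.1 hlim.cauchySeq (‖μ‖ ^ p) (by positivity)
  exact absurd (hN (N + 1) N.le_succ N le_rfl) (not_lt.2 (hsep _ _ (hφ N.lt_succ_self)))

lemma exists_biorthogonal {ι : Type*} [Finite ι] [DecidableEq ι] {φ : ι → X}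
    (h : LinearIndependent ℂ φ) :
    ∃ ℓ : ι → X →L[ℂ] ℂ, ∀ i j, ℓ i (φ j) = if i = j then 1 else 0 := by
  have : FiniteDimensional ℂ (Submodule.span ℂ (Set.range φ)) :=
    FiniteDimensional.span_of_finite ℂ (Set.finite_range φ)
  have hex : ∀ i, ∃ g : X →L[ℂ] ℂ, ∀ j, g (φ j) = if i = j then 1 else 0 := by
    intro i
    obtain ⟨g, hg, -⟩ := exists_extension_norm_eq (𝕜 := ℂ) _
      (LinearMap.toContinuousLinearMap ((Basis.span h).coord i))
    refine ⟨g, fun j => ?_⟩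
    have h1 := hg (Basis.span h j)
    rw [Basis.span_apply] at h1
    rw [h1, LinearMap.coe_toContinuousLinearMap', Basis.coord_apply]
    have hj : (⟨φ j, Submodule.subset_span ⟨j, rfl⟩⟩ : Submodule.span ℂ (Set.range φ)) =
        Basis.span h j := (Basis.span_apply h j).symm
    rw [hj, Basis.repr_self, Finsupp.single_apply]
    simp only [eq_comm]
  choose ℓ hℓ using hex
  exact ⟨ℓ, hℓ⟩

/-- The biorthogonal functionals and projections attached to the first `N` vectors of `φ`. -/
def flagProj (ℓ : ℕ → X →L[ℂ] ℂ) (φ : ℕ → X) (i : ℕ) : X →L[ℂ] X :=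
  1 - ∑ l ∈ Finset.range i, (ℓ l).smulRight (φ l)

lemma flagProj_apply (ℓ : ℕ → X →L[ℂ] ℂ) (φ : ℕ → X) (i : ℕ) (x : X) :
    flagProj ℓ φ i x = x - ∑ l ∈ Finset.range i, ℓ l x • φ l := by
  simp [flagProj]

lemma flagProj_sub_mem (ℓ : ℕ → X →L[ℂ] ℂ) (φ : ℕ → X) (i : ℕ) (x : X) :
    flagProj ℓ φ i x - x ∈ flagSpan ℂ φ i := by
  rw [flagProj_apply, sub_sub_cancel_left]
  exact Submodule.neg_mem _ (Submodule.sum_mem _ fun l hl =>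
    Submodule.smul_mem _ _ (mem_flagSpan (Finset.mem_range.1 hl)))

lemma flagProj_eq_zero {ℓ : ℕ → X →L[ℂ] ℂ} {φ : ℕ → X} {N : ℕ}
    (hℓ : ∀ i < N, ∀ j < N, ℓ i (φ j) = if i = j then 1 else 0) {i : ℕ} (hi : i ≤ N)
    {x : X} (hx : x ∈ flagSpan ℂ φ i) : flagProj ℓ φ i x = 0 := by
  have : flagSpan ℂ φ i ≤ LinearMap.ker (flagProj ℓ φ i : X →ₗ[ℂ] X) := by
    refine Submodule.span_le.2 ?_
    rintro _ ⟨j, hj, rfl⟩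
    have hj : j < i := hj
    change flagProj ℓ φ i (φ j) = 0
    rw [flagProj_apply, Finset.sum_congr rfl fun l hl => by
      rw [hℓ l ((Finset.mem_range.1 hl).trans_le hi) j (hj.trans_le hi)]]
    simp [hj]
  exact this hx

lemma IsRootFlag.exists_biorthogonal {f : End ℂ X} {Λ : ℕ → ℂ} {φ : ℕ → X} {N : ℕ}
    (h : IsRootFlag f Λ φ N) :
    ∃ ℓ : ℕ → X →L[ℂ] ℂ, ∀ i < N, ∀ j < N, ℓ i (φ j) = if i = j then 1 else 0 := by
  obtain ⟨ℓ, hℓ⟩ := _root_.exists_biorthogonal h.linearIndependent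
  refine ⟨fun i => if hi : i < N then ℓ ⟨i, hi⟩ else 0, fun i hi j hj => ?_⟩
  simpa [hi] using hℓ ⟨i, hi⟩ ⟨j, hj⟩

lemma flagProj_mul_pow {T : X →L[ℂ] X} {Λ : ℕ → ℂ} {ℓ : ℕ → X →L[ℂ] ℂ} {φ : ℕ → X} {N : ℕ}
    (h : IsRootFlag (T : X →ₗ[ℂ] X) Λ φ N)
    (hℓ : ∀ i < N, ∀ j < N, ℓ i (φ j) = if i = j then 1 else 0) {i : ℕ} (hi : i ≤ N) (n : ℕ) :
    (flagProj ℓ φ i * T) ^ (n + 1) = flagProj ℓ φ i * T ^ (n + 1) := by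
  have hcomm : ∀ y, flagProj ℓ φ i (T (flagProj ℓ φ i y)) = flagProj ℓ φ i (T y) := by
    intro y
    rw [← sub_eq_zero, ← map_sub, ← map_sub]
    exact flagProj_eq_zero hℓ hi ((h.mono hi).map_mem (flagProj_sub_mem ℓ φ i y))
  induction n with
  | zero => simp
  | succ n ih =>
    rw [pow_succ', ih]
    ext y
    have := hcomm ((T ^ (n + 1)) y)
    simpa [pow_succ' T (n + 1)] using this

/-- After removing the part of `T` carried by a root flag, only the root vectors outside the flag
contribute to the growth of the powers. -/
lemma exists_norm_flagProj_mul_pow_le [CompleteSpace X] {T : X →L[ℂ] X} {p : ℕ} (hp : p ≠ 0)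
    (hT : IsCompactOperator (T ^ p : X →L[ℂ] X)) {Λ : ℕ → ℂ} {ℓ : ℕ → X →L[ℂ] ℂ} {φ : ℕ → X} {N : ℕ}
    (h : IsRootFlag (T : X →ₗ[ℂ] X) Λ φ N)
    (hℓ : ∀ i < N, ∀ j < N, ℓ i (φ j) = if i = j then 1 else 0) {i : ℕ} (hi : i ≤ N)
    {r ρ : ℝ} (hr : 0 ≤ r) (hρ : r < ρ)
    (hle : ∀ μ ≠ 0, r < ‖μ‖ → End.maxGenEigenspace (T : X →ₗ[ℂ] X) μ ≤ flagSpan ℂ φ i) :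
    ∃ C, 0 ≤ C ∧ ∀ n, ‖flagProj ℓ φ i * T ^ n‖ ≤ C * ρ ^ n := by
  have hinv : ∀ x ∈ flagSpan ℂ φ i, (T : X →ₗ[ℂ] X) x ∈ flagSpan ℂ φ i :=
    fun x hx => (h.mono hi).map_mem hx
  obtain ⟨C, hC, hn⟩ := exists_norm_pow_le (T := flagProj ℓ φ i * T) hp (by
    obtain ⟨q, rfl⟩ := Nat.exists_eq_succ_of_ne_zero hp
    rw [Nat.succ_eq_add_one, flagProj_mul_pow h hℓ hi]
    exact hT.clm_comp (flagProj ℓ φ i)) hr hρ (by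
    intro μ hμ hev
    by_contra! hlt
    obtain ⟨x, hx⟩ := hev.exists_hasEigenvector
    have hx1 : flagProj ℓ φ i (T x) = μ • x := hx.apply_eq_smul
    have hxE : x ∈ flagSpan ℂ φ i := mem_of_sub_smul_mem hinv (hle μ hμ hlt) (by
      rw [← hx1, ← neg_sub]
      exact Submodule.neg_mem _ (flagProj_sub_mem ℓ φ i (T x)))
    have := flagProj_eq_zero hℓ hi (hinv x hxE)
    change flagProj ℓ φ i (T x) = 0 at this
    rw [hx1] at this
    exact (smul_ne_zero hμ hx.2) this)
  refine ⟨C + ‖flagProj ℓ φ i‖, by positivity, fun n => ?_⟩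
  have hρ0 : 0 < ρ := hr.trans_lt hρ
  cases n with
  | zero => simpa using hC
  | succ n =>
    rw [← flagProj_mul_pow h hℓ hi]
    refine (hn _).trans ?_
    gcongr
    simp

/-- A nonincreasing enumeration of the nonzero eigenvalues of `f`, repeated according to their
algebraic multiplicities, and possibly extended by zeros. -/
structure IsMultiplierSeq (f : End ℂ X) (Λ : ℕ → ℂ) : Prop where
  antitone : Antitone fun i => ‖Λ i‖
  eq_zero_or : ∀ i, Λ i = 0 ∨ f.HasEigenvalue (Λ i)
  card_eq : ∀ μ ≠ 0, f.HasEigenvalue μ →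
    Nat.card {i | Λ i = μ} = finrank ℂ (f.maxGenEigenspace μ)

lemma IsMultiplierSeq.finite {T : X →L[ℂ] X} {p : ℕ} (hT : IsCompactOperator (T ^ p : X →L[ℂ] X))
    {Λ : ℕ → ℂ} (hΛ : IsMultiplierSeq (T : X →ₗ[ℂ] X) Λ) {μ : ℂ} (hμ : μ ≠ 0)
    (hev : End.HasEigenvalue (T : X →ₗ[ℂ] X) μ) : {i | Λ i = μ}.Finite := by
  have := finiteDimensional_maxGenEigenspace hT hμ
  have hpos : 0 < finrank ℂ (End.maxGenEigenspace (T : X →ₗ[ℂ] X) μ) := by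
    obtain ⟨x, hx⟩ := hev.exists_hasEigenvector
    refine Module.finrank_pos_iff_exists_ne_zero.2 ⟨⟨x, ?_⟩, by simpa [Subtype.ext_iff] using hx.2⟩
    exact (End.mem_maxGenEigenspace _ _ _).2 ⟨1, by simpa [sub_eq_zero] using hx.apply_eq_smul⟩
  rw [← hΛ.card_eq μ hμ hev] at hpos
  have := Nat.finite_of_card_ne_zero hpos.ne'
  exact Set.toFinite _

lemma IsMultiplierSeq.exists_isRootFlag {T : X →L[ℂ] X} {p : ℕ}
    (hT : IsCompactOperator (T ^ p : X →L[ℂ] X)) {Λ : ℕ → ℂ}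
    (hΛ : IsMultiplierSeq (T : X →ₗ[ℂ] X) Λ) {N : ℕ} (hN : ∀ i < N, Λ i ≠ 0) :
    ∃ φ, IsRootFlag (T : X →ₗ[ℂ] X) Λ φ N := by
  refine _root_.exists_isRootFlag _ Λ N fun i hi => ?_
  have hev := (hΛ.eq_zero_or i).resolve_left (hN i hi)
  rw [← hΛ.card_eq _ (hN i hi) hev]
  have hfin := hΛ.finite hT (hN i hi) hev
  exact Set.ncard_lt_ncard (s := {j | j < i ∧ Λ j = Λ i})
    ⟨fun j hj => hj.2, fun hsub => lt_irrefl i (hsub (show Λ i = Λ i from rfl)).1⟩ hfin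

lemma IsMultiplierSeq.maxGenEigenspace_le {T : X →L[ℂ] X} {p : ℕ}
    (hT : IsCompactOperator (T ^ p : X →L[ℂ] X)) {Λ : ℕ → ℂ}
    (hΛ : IsMultiplierSeq (T : X →ₗ[ℂ] X) Λ) {φ : ℕ → X} {i : ℕ}
    (h : IsRootFlag (T : X →ₗ[ℂ] X) Λ φ i) {μ : ℂ} (hμ : μ ≠ 0) (hlt : ‖Λ i‖ < ‖μ‖) :
    End.maxGenEigenspace (T : X →ₗ[ℂ] X) μ ≤ flagSpan ℂ φ i := by
  by_cases hev : End.HasEigenvalue (T : X →ₗ[ℂ] X) μ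
  · have := finiteDimensional_maxGenEigenspace hT hμ
    refine h.maxGenEigenspace_le ?_
    rw [← hΛ.card_eq μ hμ hev]
    refine Set.ncard_le_ncard (s := {j | Λ j = μ}) (t := {j | j < i ∧ Λ j = μ}) ?_
      ((Set.finite_Iio i).subset fun j hj => hj.1)
    intro j hj
    refine ⟨lt_of_not_ge fun hij => ?_, hj⟩
    have := hΛ.antitone hij
    simp only [show Λ j = μ from hj] at this
    linarith
  · by_contra hle
    obtain ⟨x, -, hx, hfx⟩ := exists_mem_maxGenEigenspace_notMem (E := ⊥)
      (fun h' => hle (h'.trans bot_le))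
    exact hev (End.hasEigenvalue_of_hasEigenvector (x := x)
      ⟨End.mem_eigenspace_iff.2 (sub_eq_zero.1 (by simpa using hfx)), by simpa using hx⟩)

/-- Powers of an operator split into `k` rank one parts and a remainder whose growth rates are
controlled by the first `k` multipliers. -/
lemma IsMultiplierSeq.exists_decomposition [CompleteSpace X] {T : X →L[ℂ] X} {p : ℕ} (hp : p ≠ 0)
    (hT : IsCompactOperator (T ^ p : X →L[ℂ] X)) {Λ : ℕ → ℂ}
    (hΛ : IsMultiplierSeq (T : X →ₗ[ℂ] X) Λ) (k : ℕ) {ε : ℝ} (hε : 0 < ε) :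
    ∃ (C : ℝ) (e : ℕ → X) (c : ℕ → ℕ → X →L[ℂ] ℂ) (R : ℕ → X →L[ℂ] X), 0 ≤ C ∧
      (∀ n x, (T ^ n) x = ∑ l ∈ Finset.range (k + 1), c n l x • e l + R n x) ∧
      (∀ n, ∀ l < k + 1, ‖c n l‖ ≤ C * (‖Λ l‖ + ε) ^ n) ∧
      ∀ n, ‖R n‖ ≤ C * (‖Λ k‖ + ε) ^ n := by
  obtain ⟨N, hNk, hN, hNΛ⟩ : ∃ N ≤ k + 1, (∀ i < N, Λ i ≠ 0) ∧ ‖Λ N‖ ≤ ‖Λ k‖ := by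
    by_cases hall : ∀ i < k + 1, Λ i ≠ 0
    · exact ⟨k + 1, le_rfl, hall, hΛ.antitone k.le_succ⟩
    · push Not at hall
      classical
      refine ⟨Nat.find hall, (Nat.find_spec hall).1.le, fun i hi h0 => ?_, ?_⟩
      · exact Nat.find_min hall hi ⟨hi.trans (Nat.find_spec hall).1, h0⟩
      · rw [(Nat.find_spec hall).2]; simp
  obtain ⟨φ, hφ⟩ := hΛ.exists_isRootFlag hT hN
  obtain ⟨ℓ, hℓ⟩ := hφ.exists_biorthogonal
  have hgrow : ∀ i, ∃ C, 0 ≤ C ∧ (i ≤ N → ∀ n, ‖flagProj ℓ φ i * T ^ n‖ ≤ C * (‖Λ i‖ + ε) ^ n) := by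
    intro i
    by_cases hi : i ≤ N
    · obtain ⟨C, hC, h⟩ := exists_norm_flagProj_mul_pow_le hp hT hφ hℓ hi (norm_nonneg (Λ i))
        (lt_add_of_pos_right _ hε) fun μ hμ hlt => hΛ.maxGenEigenspace_le hT (hφ.mono hi) hμ hlt
      exact ⟨C, hC, fun _ => h⟩
    · exact ⟨0, le_rfl, fun h => absurd h hi⟩
  choose D hD hgrow using hgrow
  have hnn : ∀ l, 0 ≤ D l * ‖ℓ l‖ := fun l => mul_nonneg (hD l) (norm_nonneg _)
  refine ⟨D N + ∑ l ∈ Finset.range N, D l * ‖ℓ l‖, φ, fun n l => if l < N then ℓ l ∘L T ^ n else 0,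
    fun n => flagProj ℓ φ N * T ^ n, add_nonneg (hD N) (Finset.sum_nonneg fun l _ => hnn l), ?_, ?_, ?_⟩
  · intro n x
    rw [mul_apply_eq_comp, flagProj_apply, ← Finset.sum_subset (Finset.range_mono hNk)
      fun l _ hl => by simp [if_neg (fun h => hl (Finset.mem_range.2 h))]]
    have : ∀ l ∈ Finset.range N, ((if l < N then ℓ l ∘L T ^ n else 0 : X →L[ℂ] ℂ) x) • φ l =
        ℓ l ((T ^ n) x) • φ l := fun l hl => by rw [if_pos (Finset.mem_range.1 hl)]; rfl
    rw [Finset.sum_congr rfl this, add_sub_cancel]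
  · intro n l _
    have h0 : 0 ≤ ∑ l ∈ Finset.range N, D l * ‖ℓ l‖ := Finset.sum_nonneg fun l _ => hnn l
    simp only
    split_ifs with hl
    · have h1 : ℓ l ∘L T ^ n = ℓ l ∘L (flagProj ℓ φ l * T ^ n) := by
        ext x
        simp only [ContinuousLinearMap.comp_apply, mul_apply_eq_comp, flagProj_apply,
          map_sub, map_sum, map_smul]
        rw [Finset.sum_eq_zero, sub_zero]
        intro j hj
        have hj : j < l := Finset.mem_range.1 hj
        rw [hℓ l hl j (hj.trans hl), if_neg hj.ne', smul_zero]
      rw [h1]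
      refine (ContinuousLinearMap.opNorm_comp_le _ _).trans ?_
      calc ‖ℓ l‖ * ‖flagProj ℓ φ l * T ^ n‖ ≤ ‖ℓ l‖ * (D l * (‖Λ l‖ + ε) ^ n) := by
            gcongr; exact hgrow l hl.le n
        _ = (D l * ‖ℓ l‖) * (‖Λ l‖ + ε) ^ n := by ring
        _ ≤ _ := by
            gcongr
            have := Finset.single_le_sum (fun l _ => hnn l) (Finset.mem_range.2 hl)
            linarith [hD N]
    · rw [norm_zero]
      have := hD N
      positivity
  · intro n
    refine (hgrow N le_rfl n).trans ?_
    have := hD N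
    have h0 : 0 ≤ ∑ l ∈ Finset.range N, D l * ‖ℓ l‖ := Finset.sum_nonneg fun l _ => hnn l
    gcongr
    linarith

end CompactPower

section Hat

open Filter Topology

/-- The piecewise linear bump supported on `[-1, 1]`. -/
def tent (v : ℝ) : ℝ := max 0 (1 - |v|)

lemma tent_nonneg (v : ℝ) : 0 ≤ tent v := le_max_left _ _

lemma continuous_tent : Continuous tent := by unfold tent; fun_prop

lemma tent_eq_zero {v : ℝ} (h : 1 ≤ |v|) : tent v = 0 := max_eq_left (by linarith)

lemma tent_of_abs_le {v : ℝ} (h : |v| ≤ 1) : tent v = 1 - |v| := max_eq_right (by linarith)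

lemma tent_int (z : ℤ) : tent z = if z = 0 then 1 else 0 := by
  split_ifs with h
  · simp [h, tent]
  · refine tent_eq_zero ?_
    have := Int.one_le_abs h
    exact_mod_cast this

lemma exists_tent_eq_affine (c a : ℤ) :
    ∃ p q : ℝ, ∀ x ∈ Set.Icc (c : ℝ) (c + 1), tent (x - a) = p * x + q := by
  rcases lt_trichotomy a c with h | rfl | h
  · refine ⟨0, 0, fun x hx => ?_⟩
    have h' : (a : ℝ) + 1 ≤ c := by exact_mod_cast h
    rw [tent_eq_zero ((by linarith [hx.1] : (1 : ℝ) ≤ x - a).trans (le_abs_self _))]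
    ring
  · refine ⟨-1, 1 + a, fun x hx => ?_⟩
    have h0 : 0 ≤ x - a := by linarith [hx.1]
    rw [tent_of_abs_le (by rw [abs_of_nonneg h0]; linarith [hx.2]), abs_of_nonneg h0]
    ring
  · rcases (Int.add_one_le_of_lt h).lt_or_eq with h2 | rfl
    · refine ⟨0, 0, fun x hx => ?_⟩
      have h' : (c : ℝ) + 1 + 1 ≤ a := by exact_mod_cast h2
      rw [tent_eq_zero ((by linarith [hx.2] : (1 : ℝ) ≤ -(x - a)).trans (neg_le_abs _))]
      ring
    · refine ⟨1, -c, fun x hx => ?_⟩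
      push_cast
      have h0 : x - (c + 1) ≤ 0 := by linarith [hx.2]
      rw [tent_of_abs_le (by rw [abs_of_nonpos h0]; linarith [hx.1]), abs_of_nonpos h0]
      ring

lemma det_tent_update {k : ℕ} (a : Fin k → ℤ) (u : Fin k → ℝ) (m : Fin k) (c : ℤ) {x y s : ℝ}
    (hx : x ∈ Set.Icc (c : ℝ) (c + 1)) (hy : y ∈ Set.Icc (c : ℝ) (c + 1)) (hs : s ∈ Set.Icc (0 : ℝ) 1) :
    (Matrix.of fun i j => tent (Function.update u m ((1 - s) * x + s * y) j - a i)).det =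
      (1 - s) * (Matrix.of fun i j => tent (Function.update u m x j - a i)).det +
        s * (Matrix.of fun i j => tent (Function.update u m y j - a i)).det := by
  have hcol : ∀ v, (Matrix.of fun i j => tent (Function.update u m v j - a i)) =
      (Matrix.of fun i j => tent (u j - a i)).updateCol m (fun i => tent (v - a i)) := by
    intro v
    ext i j
    by_cases h : j = m
    · subst h; simp
    · simp [h]
  rw [hcol, hcol, hcol, ← smul_eq_mul, ← smul_eq_mul, ← Matrix.det_updateCol_smul,
    ← Matrix.det_updateCol_smul, ← Matrix.det_updateCol_add]
  congr 2
  ext i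
  obtain ⟨p, q, h⟩ := exists_tent_eq_affine c (a i)
  have hz : (1 - s) * x + s * y ∈ Set.Icc (c : ℝ) (c + 1) := by
    obtain ⟨h1, h2⟩ := hx; obtain ⟨h3, h4⟩ := hy; obtain ⟨h5, h6⟩ := hs
    constructor <;> nlinarith
  simp only [Pi.add_apply, Pi.smul_apply, smul_eq_mul]
  rw [h _ hx, h _ hy, h _ hz]
  ring

lemma det_tent_int_nonneg {k : ℕ} {a : Fin k → ℤ} (ha : StrictMono a) {z : Fin k → ℤ}
    (hz : Monotone z) : 0 ≤ (Matrix.of fun i j => tent ((z j : ℝ) - a i)).det := by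
  by_cases hinj : Function.Injective z
  · have hz' := hz.strictMono_of_injective hinj
    rw [Matrix.det_apply']
    refine Finset.sum_nonneg fun σ _ => ?_
    by_cases hσ : ∀ i, z i = a (σ i)
    · have hmono : StrictMono σ := fun i j hij => ha.lt_iff_lt.1 (by rw [← hσ, ← hσ]; exact hz' hij)
      have : (σ : Fin k → Fin k) = id := (hmono.range_inj strictMono_id).1 (by
        rw [Set.range_id, σ.surjective.range_eq])
      have h1 : σ = 1 := Equiv.ext fun i => congrFun this i
      rw [h1]
      simpa using Finset.prod_nonneg fun i _ => tent_nonneg _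
    · push Not at hσ
      obtain ⟨i, hi⟩ := hσ
      rw [Finset.prod_eq_zero (Finset.mem_univ i), mul_zero]
      rw [Matrix.of_apply, ← Int.cast_sub, tent_int, if_neg (sub_ne_zero.2 hi)]
  · obtain ⟨i, j, h, hij⟩ : ∃ i j, z i = z j ∧ i ≠ j := by
      simpa [Function.Injective] using hinj
    rw [Matrix.det_zero_of_column_eq hij]
    simp [h]

/-- Total positivity of integer translates of `tent`. -/
lemma det_tent_nonneg {k : ℕ} {a : Fin k → ℤ} (ha : StrictMono a) {u : Fin k → ℝ}
    (hu : Monotone u) : 0 ≤ (Matrix.of fun i j => tent (u j - a i)).det := by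
  have key : ∀ m : ℕ, ∀ u : Fin k → ℝ, Monotone u → (∀ j : Fin k, m ≤ j → ∃ z : ℤ, u j = z) →
      0 ≤ (Matrix.of fun i j => tent (u j - a i)).det := by
    intro m
    induction m with
    | zero =>
      intro u hu hint
      choose z hz using fun j => hint j (Nat.zero_le _)
      have := det_tent_int_nonneg ha (z := z) fun i j hij => by
        have := hu hij; rw [hz, hz] at this; exact_mod_cast this
      simpa [hz] using this
    | succ m ih =>
      intro u hu hint
      by_cases hmk : k ≤ m
      · exact ih u hu fun j hj => absurd j.2 (by omega)
      set q : Fin k := ⟨m, by omega⟩ with hq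
      have hint' : ∀ v : ℤ, ∀ j : Fin k, m ≤ j → ∃ z : ℤ, Function.update u q (v : ℝ) j = z := by
        intro v j hj
        by_cases hjq : j = q
        · exact ⟨v, by simp [hjq]⟩
        · rw [Function.update_of_ne hjq]
          refine hint j ?_
          have : (j : ℕ) ≠ m := fun h => hjq (Fin.ext h)
          omega
      by_cases hqz : ∃ z : ℤ, u q = z
      · obtain ⟨z, hz⟩ := hqz
        have := ih u hu fun j hj => by
          have := hint' z j hj
          rwa [← hz, Function.update_eq_self] at this
        exact this
      set c := ⌊u q⌋ with hc
      have hcu : (c : ℝ) ≤ u q := Int.floor_le _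
      have huc : u q < c + 1 := Int.lt_floor_add_one _
      have hmono : ∀ v : ℝ, (∀ j < q, u j ≤ v) → (∀ j, q < j → v ≤ u j) →
          Monotone (Function.update u q v) := by
        intro v h1 h2 i j hij
        by_cases hi : i = q <;> by_cases hj : j = q
        · rw [hi, hj]
        · rw [hi, Function.update_self, Function.update_of_ne hj]
          exact h2 j (lt_of_le_of_ne (hi ▸ hij) (Ne.symm hj))
        · rw [hj, Function.update_self, Function.update_of_ne hi]
          exact h1 i (lt_of_le_of_ne (hj ▸ hij) hi)
        · rw [Function.update_of_ne hi, Function.update_of_ne hj]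
          exact hu hij
      have hup : 0 ≤ (Matrix.of fun i j => tent (Function.update u q (c + 1 : ℝ) j - a i)).det := by
        refine ih _ (hmono _ (fun j hj => (hu hj.le).trans huc.le) fun j hj => ?_)
          (by simpa using hint' (c + 1))
        obtain ⟨z, hz⟩ := hint j hj
        have h1 : (c : ℝ) < z := by
          refine lt_of_le_of_lt hcu (lt_of_le_of_ne (hz ▸ hu hj.le) fun h => hqz ⟨z, h⟩)
        rw [hz]
        exact_mod_cast h1
      obtain ⟨l, hl1, hl2, hlow⟩ : ∃ l, (c : ℝ) ≤ l ∧ l ≤ u q ∧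
          0 ≤ (Matrix.of fun i j => tent (Function.update u q l j - a i)).det := by
        by_cases hex : ∃ j < q, (c : ℝ) < u j
        · obtain ⟨j, hj, hcj⟩ := hex
          refine ⟨u j, hcj.le, hu hj.le, ?_⟩
          rw [Matrix.det_zero_of_column_eq hj.ne]
          simp [hj.ne]
        · push Not at hex
          exact ⟨c, le_rfl, hcu, ih _ (hmono _ hex fun j hj => hcu.trans (hu hj.le)) (hint' c)⟩
      have hd : 0 < (c : ℝ) + 1 - l := by linarith
      have hs : (u q - l) / (c + 1 - l) ∈ Set.Icc (0 : ℝ) 1 :=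
        ⟨div_nonneg (by linarith) hd.le, (div_le_one hd).2 (by linarith)⟩
      have := det_tent_update a u q c (x := l) (y := c + 1) ⟨hl1, by linarith⟩ ⟨by linarith, le_rfl⟩ hs
      rw [show (1 - (u q - l) / (c + 1 - l)) * l + (u q - l) / (c + 1 - l) * ((c : ℝ) + 1) = u q by
        field_simp; ring, Function.update_eq_self] at this
      rw [this]
      exact add_nonneg (mul_nonneg (by linarith [hs.2]) hlow) (mul_nonneg hs.1 hup)
  exact key k u hu fun j hj => absurd j.2 (by omega)

lemma sum_tent {u : ℝ} (hu : 0 ≤ u) (n : ℕ) :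
    ∑ a ∈ Finset.range n, tent (u - a) = max 0 (min 1 (n - u)) := by
  induction n with
  | zero => simp [hu]
  | succ n ih =>
    rw [Finset.sum_range_succ, ih, tent]
    push_cast
    rcases le_total u n with h | h
    · rw [abs_of_nonpos (by linarith)]
      rcases le_total u (n - 1) with h' | h'
      · rw [min_eq_left (by linarith), min_eq_left (by linarith), max_eq_right (by norm_num),
          max_eq_left (by linarith), add_zero]
      · rw [min_eq_right (by linarith), min_eq_left (by linarith), max_eq_right (by linarith),
          max_eq_right (by linarith), max_eq_right (by norm_num)]
        ring
    · rw [abs_of_nonneg (by linarith), min_eq_right (by linarith), min_eq_right (by linarith),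
        max_eq_left (by linarith), zero_add]
      congr 1
      ring

/-- The piecewise linear hat functions for the uniform partition of `[-1, 0]` into `N` pieces. -/
def hat (N a : ℕ) : C(I01, ℝ) := ⟨fun θ => tent (N * ((θ : ℝ) + 1) - a),
  continuous_tent.comp (by fun_prop)⟩

lemma hat_nonneg (N a : ℕ) (θ : I01) : 0 ≤ hat N a θ := tent_nonneg _

lemma sum_hat (N : ℕ) (θ : I01) : ∑ a ∈ Finset.range (N + 1), hat N a θ = 1 := by
  have h1 := θ.2.1
  have h2 := θ.2.2
  have hN : (0 : ℝ) ≤ N := N.cast_nonneg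
  change ∑ a ∈ Finset.range (N + 1), tent (N * ((θ : ℝ) + 1) - a) = 1
  rw [sum_tent (mul_nonneg hN (by linarith)), min_eq_left (by push_cast; nlinarith),
    max_eq_right zero_le_one]

/-- A real continuous function on `[-1, 0]` regarded as a complex one. -/
def toCC (f : C(I01, ℝ)) : CC := ⟨fun θ => (f θ : ℂ), by fun_prop⟩

@[simp] lemma toCC_apply (f : C(I01, ℝ)) (θ : I01) : toCC f θ = f θ := rfl

lemma norm_sum_smul_hat_sub_le {N : ℕ} {c : ℕ → ℂ} {z : ℂ} {θ : I01} {δ : ℝ}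
    (h : ∀ a ∈ Finset.range (N + 1), hat N a θ ≠ 0 → ‖c a - z‖ ≤ δ) :
    ‖∑ a ∈ Finset.range (N + 1), c a * hat N a θ - z‖ ≤ δ := by
  have h1 : ∑ a ∈ Finset.range (N + 1), c a * hat N a θ - z =
      ∑ a ∈ Finset.range (N + 1), (c a - z) * hat N a θ := by
    simp_rw [sub_mul]
    rw [Finset.sum_sub_distrib, ← Finset.mul_sum, ← Complex.ofReal_sum, sum_hat,
      Complex.ofReal_one, mul_one]
  have h2 : δ = ∑ a ∈ Finset.range (N + 1), δ * hat N a θ := by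
    rw [← Finset.mul_sum, sum_hat, mul_one]
  rw [h1, h2]
  refine (norm_sum_le _ _).trans (Finset.sum_le_sum fun a ha => ?_)
  rw [norm_mul, Complex.norm_real, Real.norm_of_nonneg (hat_nonneg _ _ _)]
  by_cases h0 : hat N a θ = 0
  · simp [h0]
  · exact mul_le_mul_of_nonneg_right (h a ha h0) (hat_nonneg _ _ _)

lemma sum_norm_apply_hat_le (ℓ : CC →L[ℂ] ℂ) (N : ℕ) :
    ∑ a ∈ Finset.range (N + 1), ‖ℓ (toCC (hat N a))‖ ≤ ‖ℓ‖ := by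
  have hex : ∀ z : ℂ, ∃ c : ℂ, ‖c‖ ≤ 1 ∧ c * z = ‖z‖ := by
    intro z
    by_cases hz : z = 0
    · exact ⟨0, by simp, by simp [hz]⟩
    · have hz' : (‖z‖ : ℂ) ≠ 0 := by simpa using hz
      refine ⟨starRingEnd ℂ z / ‖z‖, by simp [hz], ?_⟩
      rw [div_mul_eq_mul_div, mul_comm, Complex.mul_conj']
      field_simp
  choose c hc hcz using hex
  set g : CC := ∑ a ∈ Finset.range (N + 1), c (ℓ (toCC (hat N a))) • toCC (hat N a) with hg
  have h1 : ℓ g = (∑ a ∈ Finset.range (N + 1), ‖ℓ (toCC (hat N a))‖ : ℝ) := by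
    rw [hg, map_sum, Complex.ofReal_sum]
    exact Finset.sum_congr rfl fun a _ => by rw [map_smul, smul_eq_mul, hcz]
  have h2 : ‖g‖ ≤ 1 := by
    refine (ContinuousMap.norm_le _ zero_le_one).2 fun θ => ?_
    have := norm_sum_smul_hat_sub_le (N := N) (c := fun a => c (ℓ (toCC (hat N a)))) (z := 0) (θ := θ)
      (δ := 1) fun a _ _ => by simpa using hc _
    simpa [hg, ContinuousMap.sum_apply] using this
  have h3 := ℓ.le_opNorm g
  rw [h1, Complex.norm_real, Real.norm_of_nonneg (Finset.sum_nonneg fun _ _ => norm_nonneg _)] at h3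
  exact h3.trans (mul_le_of_le_one_right (norm_nonneg _) h2)

/-- The node of index `a` in the uniform partition of `[-1, 0]` into `N` pieces. -/
def node (N a : ℕ) : I01 := Set.projIcc (-1) 0 (by norm_num) (-1 + a / N)

lemma tendsto_interpolation (g : CC) :
    Tendsto (fun N : ℕ => ∑ a ∈ Finset.range (N + 1), g (node N a) • toCC (hat N a)) atTop (𝓝 g) := by
  rw [Metric.tendsto_atTop]
  intro ε hε
  obtain ⟨δ, hδ, hg⟩ := Metric.uniformContinuous_iff.1
    (CompactSpace.uniformContinuous_of_continuous g.continuous) (ε / 2) (by positivity)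
  obtain ⟨N₀, hN₀⟩ := exists_nat_one_div_lt hδ
  refine ⟨N₀ + 1, fun N hN => ?_⟩
  have hNpos : (0 : ℝ) < N := by exact_mod_cast (Nat.succ_pos _).trans_le hN
  have hNδ : 1 / (N : ℝ) < δ := lt_of_le_of_lt (one_div_le_one_div_of_le (by positivity)
    (by exact_mod_cast hN)) hN₀
  rw [dist_eq_norm]
  refine lt_of_le_of_lt ((ContinuousMap.norm_le _ (by positivity : (0 : ℝ) ≤ ε / 2)).2
    fun θ => ?_) (half_lt_self hε)
  have := norm_sum_smul_hat_sub_le (N := N) (c := fun a => g (node N a)) (z := g θ) (θ := θ)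
    (δ := ε / 2) fun a ha hne => ?_
  · simpa [ContinuousMap.sum_apply] using this
  · rw [← dist_eq_norm]
    refine (hg ?_).le
    have haN : (a : ℝ) ≤ N := by exact_mod_cast Nat.lt_succ_iff.1 (Finset.mem_range.1 ha)
    have hnode : ((node N a : I01) : ℝ) = -1 + a / N := by
      rw [node, Set.projIcc_of_mem _ (x := -1 + (a : ℝ) / N) ⟨by
        have : 0 ≤ (a : ℝ) / N := by positivity
        linarith, by
        have : (a : ℝ) / N ≤ 1 := (div_le_one hNpos).2 haN
        linarith⟩]
    have hlt : |N * ((θ : ℝ) + 1) - a| < 1 := by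
      by_contra! h
      exact hne (tent_eq_zero h)
    rw [Subtype.dist_eq, hnode, Real.dist_eq]
    refine lt_of_lt_of_le ?_ hNδ.le
    rw [show (-1 : ℝ) + a / N - θ = -(N * ((θ : ℝ) + 1) - a) / N by field_simp; ring, abs_div, abs_neg,
      abs_of_pos hNpos]
    exact div_lt_div_of_pos_right hlt hNpos

/-- The hat functions form a totally positive family. -/
lemma det_hat_nonneg {k N : ℕ} {a : Fin k → ℕ} (ha : StrictMono a) {θ : Fin k → I01}
    (hθ : Monotone θ) : 0 ≤ (Matrix.of fun i j => hat N (a i) (θ j)).det := by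
  have := det_tent_nonneg (a := fun i => (a i : ℤ)) (fun i j h => Int.ofNat_lt.2 (ha h))
    (u := fun j => N * ((θ j : ℝ) + 1)) fun i j h => by
      have : (θ i : ℝ) ≤ θ j := hθ h
      have hN : (0 : ℝ) ≤ N := N.cast_nonneg
      dsimp only
      gcongr
  simpa [hat] using this

end Hat

section NormalizedSolution

lemma MeasureTheory.LocallyIntegrable.intervalIntegrable_real {f : ℝ → ℝ}
    (hf : LocallyIntegrable f volume) (a b : ℝ) : IntervalIntegrable f volume a b :=
  intervalIntegrable_iff.mpr
    ((hf.integrableOn_isCompact isCompact_uIcc).mono_set Set.uIoc_subset_uIcc)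

/-- Solutions of `y'(t) = -b(t) y(t-1)` for `t ≥ 0`, in integrated form. -/
def IsNormalSol (b y : ℝ → ℝ) : Prop :=
  Continuous y ∧ ∀ t, 0 ≤ t → y t = y 0 - ∫ s in (0 : ℝ)..t, b s * y (s - 1)

/-- Successive approximations of the solution of `y'(t) = -b(t) y(t-1)` with initial function `g`. -/
def stepSol (b g : ℝ → ℝ) : ℕ → ℝ → ℝ
  | 0 => fun t => g (min t 0)
  | n + 1 => fun t => g (min t 0) - ∫ s in (0 : ℝ)..max t 0, b s * stepSol b g n (s - 1)

variable {b g : ℝ → ℝ}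

lemma continuous_stepSol (hb : LocallyIntegrable b volume) (hg : Continuous g) (n : ℕ) :
    Continuous (stepSol b g n) := by
  induction n with
  | zero => exact hg.comp (by fun_prop)
  | succ n ih =>
    refine (hg.comp (by fun_prop)).sub ((intervalIntegral.continuous_primitive
      (fun u v => ?_) 0).comp (by fun_prop))
    exact (LocallyIntegrable.mul_continuous (g := fun s => stepSol b g n (s - 1))
      (by fun_prop) hb).intervalIntegrable_real u v

lemma stepSol_succ_eq (b g : ℝ → ℝ) (n : ℕ) : ∀ t ≤ (n : ℝ), stepSol b g (n + 1) t = stepSol b g n t := by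
  induction n with
  | zero =>
    intro t ht
    have ht : t ≤ 0 := by exact_mod_cast ht
    simp [stepSol, max_eq_right ht]
  | succ n ih =>
    intro t ht
    rw [stepSol, stepSol]
    dsimp only
    congr 1
    refine intervalIntegral.integral_congr fun s hs => ?_
    rw [Set.uIcc_of_le (le_max_right _ _)] at hs
    change b s * stepSol b g (n + 1) (s - 1) = b s * stepSol b g n (s - 1)
    rw [ih]
    push_cast at ht
    have hn : (0 : ℝ) ≤ n := n.cast_nonneg
    have := hs.2.trans (max_le ht (by linarith))
    linarith

lemma stepSol_eq_of_le (b g : ℝ → ℝ) {n m : ℕ} (hnm : n ≤ m) {t : ℝ} (ht : t ≤ n) :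
    stepSol b g m t = stepSol b g n t := by
  induction m, hnm using Nat.le_induction with
  | base => rfl
  | succ m hm ih => rw [stepSol_succ_eq _ _ _ _ (ht.trans (by exact_mod_cast hm)), ih]

/-- The solution of `y'(t) = -b(t) y(t-1)` with initial function `g`. -/
def normalSol (b g : ℝ → ℝ) (t : ℝ) : ℝ := stepSol b g ⌈t⌉₊ t

lemma normalSol_eq (b g : ℝ → ℝ) {n : ℕ} {t : ℝ} (ht : t ≤ n) :
    normalSol b g t = stepSol b g n t :=
  (stepSol_eq_of_le b g (Nat.ceil_le.2 ht) (Nat.le_ceil t)).symm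

lemma normalSol_of_nonpos (b g : ℝ → ℝ) {t : ℝ} (ht : t ≤ 0) : normalSol b g t = g t := by
  rw [normalSol_eq b g (n := 0) (by simpa using ht), stepSol]
  dsimp only
  rw [min_eq_left ht]

lemma continuous_normalSol (hb : LocallyIntegrable b volume) (hg : Continuous g) :
    Continuous (normalSol b g) := by
  refine continuous_iff_continuousAt.2 fun t => ?_
  obtain ⟨n, hn⟩ := exists_nat_gt t
  refine (continuous_stepSol hb hg n).continuousAt.congr ?_
  filter_upwards [Iio_mem_nhds hn] with s hs
  exact (normalSol_eq b g (le_of_lt hs)).symm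

lemma isNormalSol_normalSol (hb : LocallyIntegrable b volume) (hg : Continuous g) :
    IsNormalSol b (normalSol b g) := by
  refine ⟨continuous_normalSol hb hg, fun t ht => ?_⟩
  obtain ⟨n, hn⟩ := exists_nat_ge t
  rw [normalSol_eq b g (n := n + 1) (by push_cast; linarith), normalSol_of_nonpos b g le_rfl, stepSol]
  dsimp only
  rw [min_eq_right ht, max_eq_left ht]
  congr 1
  refine intervalIntegral.integral_congr fun s hs => ?_
  rw [Set.uIcc_of_le ht] at hs
  rw [normalSol_eq b g (n := n) (by linarith [hs.2])]

lemma exists_abs_normalSol_le (hb : LocallyIntegrable b volume) (T : ℝ) :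
    ∃ C, 0 ≤ C ∧ ∀ (g : ℝ → ℝ) (K : ℝ), Continuous g → (∀ t ≤ 0, |g t| ≤ K) →
      ∀ t ≤ T, |normalSol b g t| ≤ C * K := by
  have key : ∀ n : ℕ, ∃ C, 0 ≤ C ∧ ∀ (g : ℝ → ℝ) (K : ℝ), Continuous g → (∀ t ≤ 0, |g t| ≤ K) →
      ∀ t ≤ (n : ℝ), |normalSol b g t| ≤ C * K := by
    intro n
    induction n with
    | zero =>
      refine ⟨1, zero_le_one, fun g K _ hK t ht => ?_⟩
      have ht : t ≤ 0 := by exact_mod_cast ht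
      rw [normalSol_of_nonpos b g ht, one_mul]
      exact hK t ht
    | succ n ih =>
      obtain ⟨C, hC, h⟩ := ih
      have hI : 0 ≤ ∫ s in (0 : ℝ)..(n + 1 : ℝ), |b s| :=
        intervalIntegral.integral_nonneg (by positivity) fun _ _ => abs_nonneg _
      refine ⟨1 + (∫ s in (0 : ℝ)..(n + 1 : ℝ), |b s|) * C, by positivity, fun g K hg hK t ht => ?_⟩
      push_cast at ht
      have hK0 : 0 ≤ K := (abs_nonneg _).trans (hK 0 le_rfl)
      by_cases ht0 : t ≤ 0
      · rw [normalSol_of_nonpos b g ht0]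
        refine (hK t ht0).trans ?_
        nlinarith [mul_nonneg (mul_nonneg hI hC) hK0]
      push Not at ht0
      rw [(isNormalSol_normalSol hb hg).2 t ht0.le, normalSol_of_nonpos b g le_rfl]
      refine (abs_sub _ _).trans ?_
      have h2 : |∫ s in (0 : ℝ)..t, b s * normalSol b g (s - 1)| ≤
          ∫ s in (0 : ℝ)..t, |b s| * (C * K) := by
        rw [← Real.norm_eq_abs]
        refine intervalIntegral.norm_integral_le_of_norm_le ht0.le (Filter.Eventually.of_forall
          fun s hs => ?_) ((hb.intervalIntegrable_real _ _).abs.mul_const _)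
        rw [Real.norm_eq_abs, abs_mul]
        exact mul_le_mul_of_nonneg_left (h g K hg hK _ (by linarith [hs.2])) (abs_nonneg _)
      rw [intervalIntegral.integral_mul_const] at h2
      have h3 : ∫ s in (0 : ℝ)..t, |b s| ≤ ∫ s in (0 : ℝ)..(n + 1 : ℝ), |b s| :=
        intervalIntegral.integral_mono_interval le_rfl ht0.le ht
          (Filter.Eventually.of_forall fun _ => abs_nonneg _) (hb.intervalIntegrable_real _ _).abs
      have h4 := mul_le_mul_of_nonneg_right h3 (mul_nonneg hC hK0)
      linarith [hK 0 le_rfl]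
  obtain ⟨n, hn⟩ := exists_nat_ge T
  obtain ⟨C, hC, h⟩ := key n
  exact ⟨C, hC, fun g K hg hK t ht => h g K hg hK t (ht.trans hn)⟩

end NormalizedSolution

section DelaySolution

variable {α β : ℝ → ℝ}

/-- The integrating factor `exp (-∫₀ᵗ α)`. -/
def intFactor (α : ℝ → ℝ) (t : ℝ) : ℝ := Real.exp (-∫ s in (0 : ℝ)..t, α s)

lemma intFactor_pos (α : ℝ → ℝ) (t : ℝ) : 0 < intFactor α t := Real.exp_pos _

lemma continuous_intFactor (hα : LocallyIntegrable α volume) : Continuous (intFactor α) :=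
  Real.continuous_exp.comp (intervalIntegral.continuous_primitive
    (fun a b => hα.intervalIntegrable_real a b) 0).neg

lemma AbsolutelyContinuousOnInterval.lipschitzOnWith_comp {f h : ℝ → ℝ} {a b : ℝ} {K : NNReal}
    {S : Set ℝ} (hh : LipschitzOnWith K h S) (hf : AbsolutelyContinuousOnInterval f a b)
    (hS : Set.MapsTo f (Set.uIcc a b) S) : AbsolutelyContinuousOnInterval (h ∘ f) a b := by
  rw [absolutelyContinuousOnInterval_iff] at hf ⊢
  intro ε hε
  obtain ⟨δ, hδ, hd⟩ := hf (ε / (K + 1)) (by positivity)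
  refine ⟨δ, hδ, fun E hE hlt => ?_⟩
  calc ∑ i ∈ Finset.range E.1, dist ((h ∘ f) (E.2 i).1) ((h ∘ f) (E.2 i).2)
      ≤ ∑ i ∈ Finset.range E.1, K * dist (f (E.2 i).1) (f (E.2 i).2) :=
        Finset.sum_le_sum fun i hi => hh.dist_le_mul _ (hS (hE.1 i hi).1) _ (hS (hE.1 i hi).2)
    _ = K * ∑ i ∈ Finset.range E.1, dist (f (E.2 i).1) (f (E.2 i).2) := by rw [Finset.mul_sum]
    _ ≤ K * (ε / (K + 1)) := by gcongr; exact (hd E hE hlt).le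
    _ < (K + 1) * (ε / (K + 1)) := by gcongr; linarith
    _ = ε := by field

lemma absolutelyContinuousOnInterval_intFactor (hα : LocallyIntegrable α volume) (t : ℝ) :
    AbsolutelyContinuousOnInterval (intFactor α) 0 t := by
  have h1 := ((hα.intervalIntegrable_real 0 t).absolutelyContinuousOnInterval_intervalIntegral
    (c := 0) (by simp)).neg
  obtain ⟨K, hK⟩ := h1.exists_bound
  obtain ⟨L, hL⟩ := (Real.contDiff_exp (n := 1)).contDiffOn.exists_lipschitzOnWith (by decide)
    (convex_Icc (-K) K) isCompact_Icc
  exact h1.lipschitzOnWith_comp hL fun s hs => abs_le.1 (hK s hs)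

/-- The coefficient of the equation satisfied by a solution divided by the integrating factor. -/
def normCoeff (α β : ℝ → ℝ) (s : ℝ) : ℝ := β s * (intFactor α (s - 1) / intFactor α s)

lemma locallyIntegrable_normCoeff (hα : LocallyIntegrable α volume)
    (hβ : LocallyIntegrable β volume) : LocallyIntegrable (normCoeff α β) volume := by
  have hc := continuous_intFactor hα
  exact hβ.mul_continuous ((hc.comp (by fun_prop)).div hc fun s => (intFactor_pos α s).ne')

lemma intFactor_mul_eq (hα : LocallyIntegrable α volume) (hβ : LocallyIntegrable β volume)
    {y : ℝ → ℝ} (hy : IsNormalSol (normCoeff α β) y) {t : ℝ} (ht : 0 ≤ t) :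
    intFactor α t * y t = intFactor α 0 * y 0 - ∫ s in (0 : ℝ)..t,
      (α s * (intFactor α s * y s) + β s * (intFactor α (s - 1) * y (s - 1))) := by
  have hb := locallyIntegrable_normCoeff hα hβ
  have hby : LocallyIntegrable (fun s => normCoeff α β s * y (s - 1)) volume :=
    hb.mul_continuous (hy.1.comp (by fun_prop))
  set z : ℝ → ℝ := fun t => y 0 - ∫ s in (0 : ℝ)..t, normCoeff α β s * y (s - 1) with hz
  have hE := absolutelyContinuousOnInterval_intFactor hα t
  have hzac : AbsolutelyContinuousOnInterval z 0 t := by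
    have h0 : AbsolutelyContinuousOnInterval (fun _ : ℝ => y 0) 0 t :=
      (contDiff_const.contDiffOn).absolutelyContinuousOnInterval
    exact h0.sub ((hby.intervalIntegrable_real 0 t).absolutelyContinuousOnInterval_intervalIntegral
      (c := 0) (by simp))
  have hzy : ∀ s, 0 ≤ s → z s = y s := fun s hs => (hy.2 s hs).symm
  have h1 := hE.integral_deriv_mul_eq_sub hzac
  rw [hzy t ht, hzy 0 le_rfl] at h1
  rw [eq_sub_iff_add_eq, ← eq_sub_iff_add_eq', ← neg_sub, ← h1, ← intervalIntegral.integral_neg]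
  refine intervalIntegral.integral_congr_ae ?_
  filter_upwards [_root_.LocallyIntegrable.ae_hasDerivAt_integral hα,
    _root_.LocallyIntegrable.ae_hasDerivAt_integral hby] with s h2 h3 hs
  rw [Set.uIoc_of_le ht] at hs
  have h4 : deriv z s = -(normCoeff α β s * y (s - 1)) := ((h3 0).const_sub (y 0)).deriv
  have h5 : deriv (intFactor α) s = intFactor α s * -α s := (h2 0).neg.exp.deriv
  rw [h4, h5, hzy s hs.1.le, normCoeff]
  have := (intFactor_pos α s).ne'
  field_simp
  ring

/-- The initial function of the normalized equation belonging to `f`, extended to `ℝ`. -/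
def normInit (α : ℝ → ℝ) (f : C(I01, ℝ)) (t : ℝ) : ℝ :=
  Set.IccExtend (by norm_num : (-1 : ℝ) ≤ 0) (fun θ : I01 => f θ / intFactor α θ) t

lemma continuous_normInit (hα : LocallyIntegrable α volume) (f : C(I01, ℝ)) :
    Continuous (normInit α f) :=
  (f.continuous.div ((continuous_intFactor hα).comp continuous_subtype_val)
    fun s => (intFactor_pos α s).ne').Icc_extend'

lemma normInit_coe (α : ℝ → ℝ) (f : C(I01, ℝ)) (θ : I01) :
    normInit α f θ = f θ / intFactor α θ := Set.IccExtend_val _ _ _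

/-- The solution of the delay equation with real initial function `f`. -/
def delaySol (α β : ℝ → ℝ) (f : C(I01, ℝ)) (t : ℝ) : ℝ :=
  intFactor α t * normalSol (normCoeff α β) (normInit α f) t

lemma continuous_delaySol (hα : LocallyIntegrable α volume) (hβ : LocallyIntegrable β volume)
    (f : C(I01, ℝ)) : Continuous (delaySol α β f) :=
  (continuous_intFactor hα).mul
    (continuous_normalSol (locallyIntegrable_normCoeff hα hβ) (continuous_normInit hα f))

lemma delaySol_coe (α β : ℝ → ℝ) (f : C(I01, ℝ)) (θ : I01) : delaySol α β f θ = f θ := by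
  rw [delaySol, normalSol_of_nonpos _ _ θ.2.2, normInit_coe, mul_div_cancel₀ _ (intFactor_pos _ _).ne']

lemma isSolutionC_delaySol (hα : LocallyIntegrable α volume) (hβ : LocallyIntegrable β volume)
    (f : C(I01, ℝ)) (γ : ℝ) : IsSolutionC α β 0 γ (fun t => (delaySol α β f t : ℂ)) := by
  refine ⟨(Complex.continuous_ofReal.comp (continuous_delaySol hα hβ f)).continuousOn, fun t ht => ?_⟩
  have h := intFactor_mul_eq hα hβ (isNormalSol_normalSol (locallyIntegrable_normCoeff hα hβ)
    (continuous_normInit hα f)) ht.1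
  have h' := congrArg (fun x : ℝ => (x : ℂ)) h
  simp only [Complex.ofReal_sub, ← intervalIntegral.integral_ofReal] at h'
  simpa [delaySol] using h'

/-- The real monodromy map. -/
def realMono (hα : LocallyIntegrable α volume) (hβ : LocallyIntegrable β volume) (γ : ℝ)
    (f : C(I01, ℝ)) : C(I01, ℝ) :=
  ⟨fun θ => delaySol α β f (γ + θ), (continuous_delaySol hα hβ f).comp (by fun_prop)⟩

lemma IsMonodromy.apply_toCC {γ : ℝ} {M : CC →L[ℂ] CC} (hM : IsMonodromy α β γ M)
    (hα : LocallyIntegrable α volume) (hβ : LocallyIntegrable β volume) (f : C(I01, ℝ)) :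
    M (toCC f) = toCC (realMono hα hβ γ f) := by
  ext θ
  exact hM _ _ (isSolutionC_delaySol hα hβ f γ) (fun θ => by simp [delaySol_coe]) θ

lemma IsMonodromy.pow_apply_toCC {γ : ℝ} {M : CC →L[ℂ] CC} (hM : IsMonodromy α β γ M)
    (hα : LocallyIntegrable α volume) (hβ : LocallyIntegrable β volume) (f : C(I01, ℝ)) (n : ℕ) :
    (M ^ n) (toCC f) = toCC ((realMono hα hβ γ)^[n] f) := by
  induction n with
  | zero => simp
  | succ n ih =>
    rw [pow_succ', Function.iterate_succ_apply', ← hM.apply_toCC hα hβ, ← ih]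
    rfl

end DelaySolution

section Dominance

/-- The determinant of the values of the functions `y i` at the points `t j`. -/
def sampleDet {k : ℕ} (y : Fin k → ℝ → ℝ) (t : Fin k → ℝ) : ℝ := (Matrix.of fun i j => y i (t j)).det

/-- The minor of `sampleDet` obtained by deleting row `i` and keeping the points `p`. -/
def sampleMinor {K : ℕ} (y : Fin (K + 1) → ℝ → ℝ) (p : Fin K → ℝ) (i : Fin (K + 1)) : ℝ :=
  sampleDet (fun r => y (i.succAbove r)) p

variable {K : ℕ} {y : Fin (K + 1) → ℝ → ℝ}

lemma sampleDet_cons (y : Fin (K + 1) → ℝ → ℝ) (p : Fin K → ℝ) (T : ℝ) :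
    sampleDet y (Fin.cons T p) = ∑ i : Fin (K + 1), (-1) ^ (i : ℕ) * y i T * sampleMinor y p i := by
  rw [sampleDet, Matrix.det_succ_column_zero]
  rfl

lemma sampleDet_snoc (y : Fin (K + 1) → ℝ → ℝ) (p : Fin K → ℝ) (T : ℝ) :
    sampleDet y (Fin.snoc p T) =
      ∑ i : Fin (K + 1), (-1) ^ ((i : ℕ) + K) * y i T * sampleMinor y p i := by
  rw [sampleDet, Matrix.det_succ_column _ (Fin.last K)]
  refine Finset.sum_congr rfl fun i _ => ?_
  simp only [Matrix.of_apply, Fin.snoc_last, Fin.val_last, sampleMinor, sampleDet]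
  congr 2
  ext r c
  simp

lemma continuous_sampleDet_cons (hy : ∀ i, Continuous (y i)) (p : Fin K → ℝ) :
    Continuous fun s => sampleDet y (Fin.cons (s - 1) p) := by
  simp only [sampleDet_cons]
  refine continuous_finsetSum _ fun i _ => ?_
  have := hy i
  fun_prop

lemma sampleDet_snoc_eq_add_integral {b : ℝ → ℝ} (hb : LocallyIntegrable b volume)
    (hy : ∀ i, IsNormalSol b (y i)) (p : Fin K → ℝ) {c T : ℝ} (hc : 0 ≤ c) (hcT : c ≤ T) :
    sampleDet y (Fin.snoc p T) = sampleDet y (Fin.snoc p c) +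
      ∫ s in c..T, (-1) ^ (K + 1) * b s * sampleDet y (Fin.cons (s - 1) p) := by
  have hint : ∀ i u v, IntervalIntegrable (fun s => b s * y i (s - 1)) volume u v := fun i u v =>
    (hb.mul_continuous (g := fun s => y i (s - 1))
      ((hy i).1.comp (by fun_prop))).intervalIntegrable_real u v
  have hstep : ∀ i, y i T = y i c - ∫ s in c..T, b s * y i (s - 1) := fun i => by
    rw [(hy i).2 T (hc.trans hcT), (hy i).2 c hc,
      ← intervalIntegral.integral_add_adjacent_intervals (hint i 0 c) (hint i c T)]
    ring
  have h1 : (∫ s in c..T, (-1) ^ (K + 1) * b s * sampleDet y (Fin.cons (s - 1) p)) =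
      ∑ i : Fin (K + 1), ∫ s in c..T,
        ((-1) ^ (K + 1) * (-1) ^ (i : ℕ) * sampleMinor y p i) * (b s * y i (s - 1)) := by
    rw [← intervalIntegral.integral_finsetSum fun i _ => (hint i c T).const_mul _]
    refine intervalIntegral.integral_congr fun s _ => ?_
    simp only [sampleDet_cons, Finset.mul_sum]
    exact Finset.sum_congr rfl fun i _ => by ring
  rw [h1, sampleDet_snoc, sampleDet_snoc, ← Finset.sum_add_distrib]
  refine Finset.sum_congr rfl fun i _ => ?_
  rw [intervalIntegral.integral_const_mul, hstep i]
  ring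

lemma sampleDet_eq_zero {k : ℕ} (y : Fin k → ℝ → ℝ) {t : Fin k → ℝ} {i j : Fin k} (hij : i ≠ j)
    (h : t i = t j) : sampleDet y t = 0 :=
  Matrix.det_zero_of_column_eq hij fun r => by simp [h]

lemma sampleDet_dominated {b bh : ℝ → ℝ} (hb : LocallyIntegrable b volume)
    (hbh : LocallyIntegrable bh volume)
    (hsign : ∀ᵐ s ∂volume, 0 ≤ (-1 : ℝ) ^ (K + 1) * bh s ∧
      (-1 : ℝ) ^ (K + 1) * bh s ≤ (-1 : ℝ) ^ (K + 1) * b s)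
    {yh : Fin (K + 1) → ℝ → ℝ} (hy : ∀ i, IsNormalSol b (y i)) (hyh : ∀ i, IsNormalSol bh (yh i))
    (hbase : ∀ t : Fin (K + 1) → ℝ, Monotone t → (∀ j, t j ∈ I01) →
      0 ≤ sampleDet yh t ∧ sampleDet yh t ≤ sampleDet y t)
    {t : Fin (K + 1) → ℝ} (ht : Monotone t) (ht1 : ∀ j, -1 ≤ t j)
    (hspan : t (Fin.last K) - t 0 ≤ 1) : 0 ≤ sampleDet yh t ∧ sampleDet yh t ≤ sampleDet y t := by
  obtain ⟨n, hn⟩ := exists_nat_ge (∑ j, (t j + 1))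
  induction n generalizing t with
  | zero =>
    refine hbase t ht fun j => ⟨ht1 j, ?_⟩
    have : t j + 1 ≤ ∑ j, (t j + 1) := Finset.single_le_sum (f := fun j => t j + 1)
      (fun j _ => by linarith [ht1 j]) (Finset.mem_univ j)
    push_cast at hn
    linarith
  | succ n ih =>
    by_cases hlast : t (Fin.last K) ≤ 0
    · exact hbase t ht fun j => ⟨ht1 j, (ht (Fin.le_last j)).trans hlast⟩
    push Not at hlast
    obtain ⟨p, T, rfl⟩ : ∃ p T, t = (Fin.snoc p T : Fin (K + 1) → ℝ) :=
      ⟨Fin.init t, t (Fin.last K), (Fin.snoc_init_self t).symm⟩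
    simp only [Fin.snoc_last] at hlast hspan
    have hp : Monotone p := fun i j hij => by
      simpa using ht (Fin.castSucc_le_castSucc_iff.2 hij)
    have hp1 : ∀ j, -1 ≤ p j := fun j => by simpa using ht1 j.castSucc
    have hpT : ∀ j, p j ≤ T := fun j => by simpa using ht (Fin.le_last j.castSucc)
    have hTp : ∀ j, T - p j ≤ 1 := fun j => by
      have := ht (Fin.zero_le j.castSucc)
      simp only [Fin.snoc_castSucc] at this
      linarith
    rw [Fin.sum_univ_castSucc] at hn
    simp only [Fin.snoc_castSucc, Fin.snoc_last] at hn
    push_cast at hn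
    obtain ⟨c, hc0, hcT, hpc, hD0, hD⟩ : ∃ c, 0 ≤ c ∧ c ≤ T ∧ (∀ j, p j ≤ c) ∧
        0 ≤ sampleDet yh (Fin.snoc p c) ∧ sampleDet yh (Fin.snoc p c) ≤ sampleDet y (Fin.snoc p c) := by
      by_cases hp0 : ∀ j, p j ≤ 0
      · refine ⟨0, le_rfl, hlast.le, hp0, hbase _ ?_ ?_⟩
        · intro i j hij
          induction j using Fin.lastCases with
          | last =>
            induction i using Fin.lastCases with
            | last => rfl
            | cast i => simpa using hp0 i
          | cast j =>
            induction i using Fin.lastCases with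
            | last => exact absurd (hij.trans_lt (Fin.castSucc_lt_last j)) (lt_irrefl _)
            | cast i => simpa using hp (Fin.castSucc_le_castSucc_iff.1 hij)
        · intro j
          induction j using Fin.lastCases with
          | last => simp
          | cast j => simpa using ⟨hp1 j, hp0 j⟩
      · push Not at hp0
        obtain ⟨j1, hj1⟩ := hp0
        have : Nonempty (Fin K) := ⟨j1⟩
        obtain ⟨j0, hj0⟩ := Finite.exists_max p
        have hz : ∀ y : Fin (K + 1) → ℝ → ℝ, sampleDet y (Fin.snoc p (p j0)) = 0 := fun y =>
          sampleDet_eq_zero y (Fin.castSucc_lt_last j0).ne (by simp)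
        exact ⟨p j0, (hj1.trans_le (hj0 j1)).le, hpT j0, hj0, by rw [hz], by rw [hz, hz]⟩
    have key : ∀ s ∈ Set.Icc c T, 0 ≤ sampleDet yh (Fin.cons (s - 1) p) ∧
        sampleDet yh (Fin.cons (s - 1) p) ≤ sampleDet y (Fin.cons (s - 1) p) := by
      intro s hs
      refine ih (t := Fin.cons (s - 1) p) ?_ ?_ ?_ ?_
      · intro i j hij
        induction j using Fin.cases with
        | zero => rw [Fin.le_zero_iff.1 hij]
        | succ j =>
          induction i using Fin.cases with
          | zero =>
            simp only [Fin.cons_zero, Fin.cons_succ]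
            linarith [hTp j, hs.2]
          | succ i => simpa using hp (Fin.succ_le_succ_iff.1 hij)
      · intro j
        induction j using Fin.cases with
        | zero =>
          simp only [Fin.cons_zero]
          linarith [hs.1]
        | succ j => simpa using hp1 j
      · have : ∀ j, (Fin.cons (s - 1) p : Fin (K + 1) → ℝ) j ≤ s := by
          intro j
          induction j using Fin.cases with
          | zero => simp
          | succ j => simpa using (hpc j).trans hs.1
        have := this (Fin.last K)
        simp only [Fin.cons_zero]
        linarith
      · rw [Fin.sum_univ_succ]
        simp only [Fin.cons_zero, Fin.cons_succ]
        linarith [hs.2]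
    have hintg : ∀ {b : ℝ → ℝ} {y : Fin (K + 1) → ℝ → ℝ}, LocallyIntegrable b volume →
        (∀ i, IsNormalSol b (y i)) → IntervalIntegrable
          (fun s => (-1) ^ (K + 1) * b s * sampleDet y (Fin.cons (s - 1) p)) volume c T :=
      fun hb hy => by
        have := ((hb.mul_continuous
          (continuous_sampleDet_cons (fun i => (hy i).1) p)).intervalIntegrable_real c T).const_mul
          ((-1) ^ (K + 1))
        simpa only [mul_assoc] using this
    have hmem : ∀ᵐ s ∂volume.restrict (Set.Icc c T), s ∈ Set.Icc c T :=
      ae_restrict_mem measurableSet_Icc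
    rw [sampleDet_snoc_eq_add_integral hb hy p hc0 hcT,
      sampleDet_snoc_eq_add_integral hbh hyh p hc0 hcT]
    constructor
    · refine add_nonneg hD0 (intervalIntegral.integral_nonneg_of_ae_restrict hcT ?_)
      filter_upwards [hmem, ae_restrict_of_ae hsign] with s hs hs'
      exact mul_nonneg hs'.1 (key s hs).1
    · refine add_le_add hD (intervalIntegral.integral_mono_ae_restrict hcT (hintg hbh hyh)
        (hintg hb hy) ?_)
      filter_upwards [hmem, ae_restrict_of_ae hsign] with s hs hs'
      exact mul_le_mul hs'.2 (key s hs).2 (key s hs).1 (hs'.1.trans hs'.2)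

/-- All determinants of values of `fh` at ordered points are nonnegative and dominated by
those of `f`. -/
def DetDom {k : ℕ} (fh f : Fin k → C(I01, ℝ)) : Prop :=
  ∀ θ : Fin k → I01, Monotone θ → 0 ≤ (Matrix.of fun i j => fh i (θ j)).det ∧
    (Matrix.of fun i j => fh i (θ j)).det ≤ (Matrix.of fun i j => f i (θ j)).det

variable {α β βh : ℝ → ℝ}

lemma DetDom.realMono (hα : LocallyIntegrable α volume) (hβ : LocallyIntegrable β volume)
    (hβh : LocallyIntegrable βh volume) {γ : ℝ} (hγ : 0 ≤ γ)
    (hsign : ∀ᵐ s ∂volume, 0 ≤ (-1 : ℝ) ^ (K + 1) * βh s ∧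
      (-1 : ℝ) ^ (K + 1) * βh s ≤ (-1 : ℝ) ^ (K + 1) * β s)
    {fh f : Fin (K + 1) → C(I01, ℝ)} (h : DetDom fh f) :
    DetDom (fun i => realMono hα hβh γ (fh i)) (fun i => realMono hα hβ γ (f i)) := by
  intro θ hθ
  have hb := locallyIntegrable_normCoeff hα hβ
  have hbh := locallyIntegrable_normCoeff hα hβh
  have hfac : ∀ (β : ℝ → ℝ) (f : Fin (K + 1) → C(I01, ℝ)) (t : Fin (K + 1) → ℝ),
      (Matrix.of fun i j => delaySol α β (f i) (t j)).det = (∏ j, intFactor α (t j)) *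
        sampleDet (fun i => normalSol (normCoeff α β) (normInit α (f i))) t := fun β f t => by
    rw [sampleDet, ← Matrix.det_mul_row]
    rfl
  have hE : ∀ t : Fin (K + 1) → ℝ, 0 < ∏ j, intFactor α (t j) := fun t =>
    Finset.prod_pos fun j _ => intFactor_pos α _
  have hmain := sampleDet_dominated hb hbh (y := fun i => normalSol (normCoeff α β) (normInit α (f i)))
    (yh := fun i => normalSol (normCoeff α βh) (normInit α (fh i))) ?_
    (fun i => isNormalSol_normalSol hb (continuous_normInit hα _))
    (fun i => isNormalSol_normalSol hbh (continuous_normInit hα _)) ?_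
    (t := fun j => γ + θ j) ?_ ?_ ?_
  · have h1 := hfac β f fun j => γ + θ j
    have h2 := hfac βh fh fun j => γ + θ j
    change 0 ≤ (Matrix.of fun i j => delaySol α βh (fh i) (γ + θ j)).det ∧
      (Matrix.of fun i j => delaySol α βh (fh i) (γ + θ j)).det ≤
      (Matrix.of fun i j => delaySol α β (f i) (γ + θ j)).det
    rw [h1, h2]
    exact ⟨mul_nonneg (hE _).le hmain.1, mul_le_mul_of_nonneg_left hmain.2 (hE _).le⟩
  · filter_upwards [hsign] with s hs
    have hq := div_pos (intFactor_pos α (s - 1)) (intFactor_pos α s)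
    simp only [normCoeff, ← mul_assoc]
    exact ⟨mul_nonneg hs.1 hq.le, mul_le_mul_of_nonneg_right hs.2 hq.le⟩
  · intro t ht htI
    have h1 := hfac β f t
    have h2 := hfac βh fh t
    have h3 := h (fun j => ⟨t j, htI j⟩) ht
    have h4 : ∀ (β : ℝ → ℝ) (f : Fin (K + 1) → C(I01, ℝ)),
        (Matrix.of fun i j => delaySol α β (f i) (t j)) = Matrix.of fun i j => f i ⟨t j, htI j⟩ :=
      fun β f => by
        ext i j
        exact delaySol_coe α β (f i) ⟨t j, htI j⟩
    rw [h4] at h1 h2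
    rw [h1, h2] at h3
    exact ⟨nonneg_of_mul_nonneg_right h3.1 (hE t), le_of_mul_le_mul_left h3.2 (hE t)⟩
  · exact fun i j hij => by simpa using hθ hij
  · exact fun j => by linarith [(θ j).2.1]
  · linarith [(θ (Fin.last K)).2.2, (θ 0).2.1]

lemma DetDom.iterate_realMono (hα : LocallyIntegrable α volume) (hβ : LocallyIntegrable β volume)
    (hβh : LocallyIntegrable βh volume) {γ : ℝ} (hγ : 0 ≤ γ)
    (hsign : ∀ᵐ s ∂volume, 0 ≤ (-1 : ℝ) ^ (K + 1) * βh s ∧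
      (-1 : ℝ) ^ (K + 1) * βh s ≤ (-1 : ℝ) ^ (K + 1) * β s)
    {fh f : Fin (K + 1) → C(I01, ℝ)} (h : DetDom fh f) (n : ℕ) :
    DetDom (fun i => (_root_.realMono hα hβh γ)^[n] (fh i))
      (fun i => (_root_.realMono hα hβ γ)^[n] (f i)) := by
  induction n with
  | zero => exact h
  | succ n ih =>
    simp only [Function.iterate_succ_apply']
    exact ih.realMono hα hβ hβh hγ hsign

lemma norm_det_pow_apply_hat_le (hα : LocallyIntegrable α volume) (hβ : LocallyIntegrable β volume)
    (hβh : LocallyIntegrable βh volume) {γ : ℝ} (hγ : 0 ≤ γ)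
    (hsign : ∀ᵐ s ∂volume, 0 ≤ (-1 : ℝ) ^ (K + 1) * βh s ∧
      (-1 : ℝ) ^ (K + 1) * βh s ≤ (-1 : ℝ) ^ (K + 1) * β s)
    {M Mh : CC →L[ℂ] CC} (hM : IsMonodromy α β γ M) (hMh : IsMonodromy α βh γ Mh)
    (N n : ℕ) (a : Fin (K + 1) → ℕ) {θ : Fin (K + 1) → I01} (hθ : Monotone θ) :
    ‖(Matrix.of fun i j => (Mh ^ n) (toCC (hat N (a i))) (θ j)).det‖ ≤
      ‖(Matrix.of fun i j => (M ^ n) (toCC (hat N (a i))) (θ j)).det‖ := by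
  by_cases ha : Function.Injective a
  · set σ := Tuple.sort a
    have hσ : StrictMono (a ∘ σ) :=
      (Tuple.monotone_sort a).strictMono_of_injective (ha.comp σ.injective)
    have hdom : DetDom (fun i => hat N ((a ∘ σ) i)) (fun i => hat N ((a ∘ σ) i)) :=
      fun θ hθ => ⟨det_hat_nonneg hσ hθ, le_rfl⟩
    obtain ⟨h0, h1⟩ := hdom.iterate_realMono hα hβ hβh hγ hsign n θ hθ
    have h2 : ∀ (β : ℝ → ℝ) (hβ : LocallyIntegrable β volume) (M : CC →L[ℂ] CC),
        IsMonodromy α β γ M → ‖(Matrix.of fun i j => (M ^ n) (toCC (hat N (a i))) (θ j)).det‖ =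
        |(Matrix.of fun i j => ((_root_.realMono hα hβ γ)^[n] (hat N ((a ∘ σ) i))) (θ j)).det| := by
      intro β hβ M hM
      have h3 := Matrix.det_permute σ
        (Matrix.of fun i j => (M ^ n) (toCC (hat N (a i))) (θ j))
      have h4 : ((Matrix.of fun i j => (M ^ n) (toCC (hat N (a i))) (θ j)).submatrix σ id) =
          (Matrix.of fun i j => ((_root_.realMono hα hβ γ)^[n] (hat N ((a ∘ σ) i))) (θ j)).map
            Complex.ofRealHom := by
        ext i j
        simp [hM.pow_apply_toCC hα hβ]
      rw [h4, ← RingHom.mapMatrix_apply, ← RingHom.map_det] at h3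
      have h5 := congrArg norm h3
      rw [norm_mul] at h5
      have h6 : ‖((Equiv.Perm.sign σ : ℤ) : ℂ)‖ = 1 := by
        rcases Int.units_eq_one_or (Equiv.Perm.sign σ) with h | h <;> simp [h]
      rw [h6, one_mul] at h5
      rw [← h5]
      exact Complex.norm_real _
    rw [h2 β hβ M hM, h2 βh hβh Mh hMh, abs_of_nonneg h0, abs_of_nonneg (h0.trans h1)]
    exact h1
  · rw [Function.Injective] at ha
    push Not at ha
    obtain ⟨i, j, hij, hne⟩ := ha
    rw [Matrix.det_zero_of_row_eq hne, norm_zero]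
    · exact norm_nonneg _
    · ext c
      simp [hij]

end Dominance

section Compactness

/-- A family of functions that is uniformly equicontinuous on the part of `I01` above `τ`. -/
def EquicontAbove (S : Set CC) (τ : ℝ) : Prop :=
  ∀ ε > 0, ∃ δ > 0, ∀ f ∈ S, ∀ θ θ' : I01, τ ≤ θ → τ ≤ θ' → |(θ : ℝ) - θ'| < δ → ‖f θ - f θ'‖ < ε

lemma EquicontAbove.exists_isCompact {S : Set CC} (hS : EquicontAbove S (-1)) {B : ℝ}
    (hB : ∀ f ∈ S, ‖f‖ ≤ B) : ∃ K : Set CC, IsCompact K ∧ S ⊆ K := by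
  set e := ContinuousMap.isometryEquivBoundedOfCompact I01 ℂ
  have h : IsCompact (closure (e '' S)) := by
    refine BoundedContinuousFunction.arzela_ascoli (Metric.closedBall 0 B)
      (isCompact_closedBall 0 B) _ ?_ ?_
    · rintro _ x ⟨f, hf, rfl⟩
      rw [mem_closedBall_zero_iff]
      exact (f.norm_coe_le_norm x).trans (hB f hf)
    · refine (Metric.uniformEquicontinuous_iff.2 fun ε hε => ?_).equicontinuous
      obtain ⟨δ, hδ, h⟩ := hS ε hε
      refine ⟨δ, hδ, fun x y hxy => ?_⟩
      rintro ⟨_, f, hf, rfl⟩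
      rw [dist_eq_norm]
      exact h f hf x y x.2.1 y.2.1 hxy
  refine ⟨e.symm '' closure (e '' S), h.image e.symm.continuous, fun f hf => ?_⟩
  exact ⟨e f, subset_closure ⟨f, hf, rfl⟩, e.symm_apply_apply f⟩

variable {α β : ℝ → ℝ}

lemma MeasureTheory.LocallyIntegrable.intervalIntegrable_complex {f : ℝ → ℝ}
    (hf : LocallyIntegrable f volume) (u v : ℝ) :
    IntervalIntegrable (fun s => (f s : ℂ)) volume u v :=
  ⟨(hf.intervalIntegrable_real u v).1.ofReal, (hf.intervalIntegrable_real u v).2.ofReal⟩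

lemma intervalIntegrable_delay (hα : LocallyIntegrable α volume)
    (hβ : LocallyIntegrable β volume) {x : ℝ → ℂ} (hx : Continuous x) (u v : ℝ) :
    IntervalIntegrable (fun s => (α s : ℂ) * x s + (β s : ℂ) * x (s - 1)) volume u v :=
  ((hα.intervalIntegrable_complex u v).mul_continuousOn hx.continuousOn).add
    ((hβ.intervalIntegrable_complex u v).mul_continuousOn
      (hx.comp (by fun_prop : Continuous fun s : ℝ => s - 1)).continuousOn)

lemma exists_abs_delaySol_le (hα : LocallyIntegrable α volume) (hβ : LocallyIntegrable β volume)
    (γ : ℝ) : ∃ C, 0 ≤ C ∧ ∀ f : C(I01, ℝ), ∀ t ∈ Set.Icc (-1) γ, |delaySol α β f t| ≤ C * ‖f‖ := by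
  obtain ⟨C, hC, h⟩ := exists_abs_normalSol_le (locallyIntegrable_normCoeff hα hβ) γ
  have hE := continuous_intFactor hα
  obtain ⟨A, hA⟩ := (isCompact_Icc (a := (-1 : ℝ)) (b := γ)).exists_bound_of_continuousOn
    hE.continuousOn
  obtain ⟨A', hA'⟩ := (isCompact_Icc (a := (-1 : ℝ)) (b := 0)).exists_bound_of_continuousOn
    (hE.inv₀ fun s => (intFactor_pos α s).ne').continuousOn
  refine ⟨|A| * (C * |A'|), by positivity, fun f t ht => ?_⟩
  have h1 : ∀ t ≤ 0, |normInit α f t| ≤ |A'| * ‖f‖ := fun t _ => by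
    simp only [normInit, Set.IccExtend, Function.comp_apply]
    set θ := Set.projIcc (-1 : ℝ) 0 (by norm_num) t
    rw [div_eq_inv_mul, abs_mul]
    exact mul_le_mul ((hA' θ θ.2).trans (le_abs_self _)) (f.norm_coe_le_norm θ) (abs_nonneg _)
      (abs_nonneg _)
  have h2 := h _ _ (continuous_normInit hα f) h1 t ht.2
  rw [delaySol, abs_mul]
  calc _ ≤ |A| * (C * (|A'| * ‖f‖)) :=
        mul_le_mul ((hA t ht).trans (le_abs_self _)) h2 (abs_nonneg _) (abs_nonneg _)
    _ = _ := by ring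

lemma exists_isSolutionC (hα : LocallyIntegrable α volume) (hβ : LocallyIntegrable β volume)
    (γ : ℝ) : ∃ C, 0 ≤ C ∧ ∀ φ : CC, ∃ x : ℝ → ℂ, Continuous x ∧ IsSolutionC α β 0 γ x ∧
      (∀ θ : I01, x θ = φ θ) ∧ ∀ t ∈ Set.Icc (-1) γ, ‖x t‖ ≤ C * ‖φ‖ := by
  obtain ⟨C, hC, h⟩ := exists_abs_delaySol_le hα hβ γ
  refine ⟨C + C, by positivity, fun φ => ?_⟩
  set f : C(I01, ℝ) := ⟨fun θ => (φ θ).re, by fun_prop⟩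
  set g : C(I01, ℝ) := ⟨fun θ => (φ θ).im, by fun_prop⟩
  have hf : ‖f‖ ≤ ‖φ‖ := (ContinuousMap.norm_le _ (norm_nonneg _)).2 fun θ =>
    (Complex.abs_re_le_norm _).trans (φ.norm_coe_le_norm θ)
  have hg : ‖g‖ ≤ ‖φ‖ := (ContinuousMap.norm_le _ (norm_nonneg _)).2 fun θ =>
    (Complex.abs_im_le_norm _).trans (φ.norm_coe_le_norm θ)
  have cf : Continuous fun t => (delaySol α β f t : ℂ) :=
    Complex.continuous_ofReal.comp (continuous_delaySol hα hβ f)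
  have cg : Continuous fun t => (delaySol α β g t : ℂ) :=
    Complex.continuous_ofReal.comp (continuous_delaySol hα hβ g)
  have cx : Continuous fun t => (delaySol α β f t : ℂ) + Complex.I * (delaySol α β g t : ℂ) :=
    cf.add (continuous_const.mul cg)
  refine ⟨_, cx, ⟨cx.continuousOn, fun t ht => ?_⟩, fun θ => ?_, fun t ht => ?_⟩
  · have h1 := (isSolutionC_delaySol hα hβ f γ).2 t ht
    have h2 := (isSolutionC_delaySol hα hβ g γ).2 t ht
    simp only at h1 h2
    have h3 := intervalIntegral.integral_add (intervalIntegrable_delay hα hβ cf 0 t)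
      ((intervalIntegrable_delay hα hβ cg 0 t).const_mul Complex.I)
    rw [intervalIntegral.integral_const_mul] at h3
    have h4 : (∫ s in (0 : ℝ)..t, ((α s : ℂ) * ((delaySol α β f s : ℂ) +
        Complex.I * (delaySol α β g s : ℂ)) + (β s : ℂ) * ((delaySol α β f (s - 1) : ℂ) +
        Complex.I * (delaySol α β g (s - 1) : ℂ)))) = _ :=
      (intervalIntegral.integral_congr fun s _ => by ring).trans h3
    rw [h4]
    dsimp only
    rw [h1, h2]
    ring
  · simp only [delaySol_coe]
    rw [mul_comm]
    exact Complex.re_add_im (φ θ)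
  · refine (norm_add_le _ _).trans ?_
    rw [norm_mul, Complex.norm_I, one_mul, Complex.norm_real, Complex.norm_real, add_mul]
    exact add_le_add ((h f t ht).trans (mul_le_mul_of_nonneg_left hf hC))
      ((h g t ht).trans (mul_le_mul_of_nonneg_left hg hC))

lemma IsSolutionC.norm_sub_le (hα : LocallyIntegrable α volume) (hβ : LocallyIntegrable β volume)
    {γ : ℝ} {x : ℝ → ℂ} (hx : Continuous x) (h : IsSolutionC α β 0 γ x) {B : ℝ}
    (hB : ∀ t ∈ Set.Icc (-1) γ, ‖x t‖ ≤ B) {s t : ℝ} (hs : s ∈ Set.Icc 0 γ)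
    (ht : t ∈ Set.Icc 0 γ) : ‖x t - x s‖ ≤
      B * |(∫ r in (0 : ℝ)..t, (|α r| + |β r|)) - ∫ r in (0 : ℝ)..s, (|α r| + |β r|)| := by
  wlog hst : s ≤ t generalizing s t
  · rw [norm_sub_rev, abs_sub_comm]
    exact this ht hs (le_of_not_ge hst)
  have hI : ∀ u v, IntervalIntegrable (fun r => |α r| + |β r|) volume u v := fun u v =>
    (hα.intervalIntegrable_real u v).abs.add (hβ.intervalIntegrable_real u v).abs
  have h1 : x t - x s = - ∫ r in s..t, ((α r : ℂ) * x r + (β r : ℂ) * x (r - 1)) := by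
    rw [h.2 t ht, h.2 s hs, ← intervalIntegral.integral_add_adjacent_intervals
      (intervalIntegrable_delay hα hβ hx 0 s) (intervalIntegrable_delay hα hβ hx s t)]
    ring
  rw [h1, norm_neg, intervalIntegral.integral_interval_sub_left (hI _ _) (hI _ _), abs_of_nonneg
    (intervalIntegral.integral_nonneg hst fun _ _ => by positivity), mul_comm,
    ← intervalIntegral.integral_mul_const]
  refine intervalIntegral.norm_integral_le_of_norm_le hst (Filter.Eventually.of_forall
    fun r hr => ?_) ((hI _ _).mul_const _)
  have hr0 : 0 ≤ r := hs.1.trans hr.1.le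
  have hrγ : r ≤ γ := hr.2.trans ht.2
  refine (norm_add_le _ _).trans ?_
  rw [norm_mul, norm_mul, Complex.norm_real, Complex.norm_real, add_mul]
  exact add_le_add (mul_le_mul_of_nonneg_left (hB r ⟨by linarith, hrγ⟩) (abs_nonneg _))
    (mul_le_mul_of_nonneg_left (hB _ ⟨by linarith, by linarith⟩) (abs_nonneg _))

lemma EquicontAbove.image_monodromy (hα : LocallyIntegrable α volume)
    (hβ : LocallyIntegrable β volume) {γ : ℝ} (hγ : 0 ≤ γ) {M : CC →L[ℂ] CC}
    (hM : IsMonodromy α β γ M) {S : Set CC} {τ B : ℝ} (hτ : τ ≤ 0) (hS : EquicontAbove S τ)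
    (hB : ∀ f ∈ S, ‖f‖ ≤ B) : EquicontAbove (M '' S) (τ - γ) := by
  obtain ⟨C, hC, hsol⟩ := exists_isSolutionC hα hβ γ
  intro ε hε
  set F : ℝ → ℝ := fun t => ∫ r in (0 : ℝ)..t, (|α r| + |β r|)
  have hF : Continuous F := intervalIntegral.continuous_primitive (fun u v =>
    (hα.intervalIntegrable_real u v).abs.add (hβ.intervalIntegrable_real u v).abs) 0
  obtain ⟨δ₁, hδ₁, h1⟩ := hS (ε / 2) (by positivity)
  obtain ⟨δ₂, hδ₂, h2⟩ := Metric.uniformContinuousOn_iff.1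
    (isCompact_Icc.uniformContinuousOn_of_continuous (hF.continuousOn (s := Set.Icc 0 γ)))
    (ε / 2 / (C * |B| + 1)) (by positivity)
  refine ⟨min δ₁ δ₂, lt_min hδ₁ hδ₂, ?_⟩
  rintro _ ⟨f, hf, rfl⟩ θ θ' hθ hθ' hd
  obtain ⟨x, hx, hxs, hx0, hxB⟩ := hsol f
  rw [hM f x hxs hx0 θ, hM f x hxs hx0 θ']
  have hB' : ∀ t ∈ Set.Icc (-1) γ, ‖x t‖ ≤ C * |B| := fun t ht =>
    (hxB t ht).trans (mul_le_mul_of_nonneg_left ((hB f hf).trans (le_abs_self B)) hC)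
  have hsplit : ∀ t, x t = x (min t 0) + x (max t 0) - x 0 := fun t => by
    rcases le_total t 0 with h | h <;> simp [h]
  set u := γ + (θ : ℝ) with hu
  set u' := γ + (θ' : ℝ) with hu'
  have hd' : |u - u'| < min δ₁ δ₂ := by simpa [hu, hu'] using hd
  have hmin : |min u 0 - min u' 0| < δ₁ := by
    refine (abs_min_sub_min_le_max _ _ _ _).trans_lt ?_
    exact max_lt (hd'.trans_le (min_le_left _ _)) (by simpa using hδ₁)
  have hmax : |max u 0 - max u' 0| < δ₂ := by
    refine (abs_max_sub_max_le_max _ _ _ _).trans_lt ?_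
    exact max_lt (hd'.trans_le (min_le_right _ _)) (by simpa using hδ₂)
  have hminI : ∀ θ : I01, min (γ + (θ : ℝ)) 0 ∈ I01 := fun θ =>
    ⟨le_min (by linarith [θ.2.1]) (by norm_num), min_le_right _ _⟩
  have hmaxI : ∀ θ : I01, max (γ + (θ : ℝ)) 0 ∈ Set.Icc 0 γ := fun θ =>
    ⟨le_max_right _ _, max_le (by linarith [θ.2.2]) hγ⟩
  have e1 : ‖x (min u 0) - x (min u' 0)‖ < ε / 2 := by
    have := h1 f hf ⟨_, hminI θ⟩ ⟨_, hminI θ'⟩ (le_min (by linarith) hτ) (le_min (by linarith) hτ)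
      hmin
    rwa [← hx0, ← hx0] at this
  have e2 : ‖x (max u 0) - x (max u' 0)‖ < ε / 2 := by
    refine (hxs.norm_sub_le hα hβ hx hB' (hmaxI θ') (hmaxI θ)).trans_lt ?_
    have := h2 _ (hmaxI θ) _ (hmaxI θ') hmax
    rw [Real.dist_eq, lt_div_iff₀ (by positivity)] at this
    refine lt_of_le_of_lt ?_ this
    rw [mul_comm]
    exact mul_le_mul_of_nonneg_left (by linarith) (abs_nonneg _)
  calc ‖x u - x u'‖ = ‖(x (min u 0) - x (min u' 0)) + (x (max u 0) - x (max u' 0))‖ := by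
        rw [hsplit u, hsplit u']
        congr 1
        ring
    _ < ε := by linarith [norm_add_le (x (min u 0) - x (min u' 0)) (x (max u 0) - x (max u' 0))]

lemma IsMonodromy.exists_isCompactOperator_pow (hα : LocallyIntegrable α volume)
    (hβ : LocallyIntegrable β volume) {γ : ℝ} (hγ : 0 < γ) {M : CC →L[ℂ] CC}
    (hM : IsMonodromy α β γ M) : ∃ p ≠ 0, IsCompactOperator (M ^ p : CC →L[ℂ] CC) := by
  have key : ∀ p : ℕ, EquicontAbove ((M ^ p : CC →L[ℂ] CC) '' Metric.closedBall 0 1) (-(p * γ)) := by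
    intro p
    induction p with
    | zero =>
      refine fun ε hε => ⟨1, one_pos, fun f _ θ θ' h h' _ => ?_⟩
      have : θ = θ' := Subtype.ext (by
        simp only [Nat.cast_zero, zero_mul, neg_zero] at h h'
        linarith [θ.2.2, θ'.2.2])
      simpa [this] using hε
    | succ p ih =>
      have h := ih.image_monodromy hα hβ hγ.le hM (by simp only [neg_nonpos]; positivity)
        (B := ‖M ^ p‖) (by
          rintro _ ⟨f, hf, rfl⟩
          exact (M ^ p).unit_le_opNorm f (mem_closedBall_zero_iff.1 hf))
      rw [← Set.image_comp] at h
      convert h using 1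
      · rw [pow_succ']
        rfl
      · push_cast
        ring
  obtain ⟨p, hp⟩ := exists_nat_gt (1 / γ)
  have hp1 : 1 < p * γ := (div_lt_iff₀ hγ).1 hp
  obtain ⟨K, hK, hsub⟩ := EquicontAbove.exists_isCompact (S := (M ^ p : CC →L[ℂ] CC) ''
    Metric.closedBall 0 1) (B := ‖M ^ p‖) (fun ε hε => by
      obtain ⟨δ, hδ, h⟩ := key p ε hε
      exact ⟨δ, hδ, fun f hf θ θ' ht ht' => h f hf θ θ' (by linarith) (by linarith)⟩) (by
      rintro _ ⟨f, hf, rfl⟩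
      exact (M ^ p).unit_le_opNorm f (mem_closedBall_zero_iff.1 hf))
  refine ⟨p, by rintro rfl; simp at hp1; linarith, K, hK, ?_⟩
  exact Filter.mem_of_superset (Metric.closedBall_mem_nhds 0 one_pos) (Set.image_subset_iff.1 hsub)

end Compactness

section DeterminantBounds

open Filter Topology

lemma Matrix.det_sum_rows {ι n : Type*} [Fintype n] [DecidableEq n] (s : Finset ι)
    (v : n → ι → n → ℂ) : (Matrix.of fun i j => ∑ a ∈ s, v i a j).det =
      ∑ a ∈ Fintype.piFinset fun _ : n => s, (Matrix.of fun i j => v i (a i) j).det := by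
  have h := (Matrix.detRowAlternating (R := ℂ) (n := n)).toMultilinearMap.map_sum_finset
    v (fun _ => s)
  refine Eq.trans ?_ h
  change Matrix.det _ = Matrix.det _
  congr 1
  ext i j
  simp

lemma Matrix.det_sum_mul_rows {ι n : Type*} [Fintype n] [DecidableEq n] (s : Finset ι)
    (c : n → ι → ℂ) (w : ι → n → ℂ) : (Matrix.of fun i j => ∑ a ∈ s, c i a * w a j).det =
      ∑ a ∈ Fintype.piFinset fun _ : n => s,
        (∏ i, c i (a i)) * (Matrix.of fun i j => w (a i) j).det := by
  rw [Matrix.det_sum_rows s fun i a j => c i a * w a j]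
  exact Finset.sum_congr rfl fun a _ =>
    Matrix.det_mul_column (fun i => c i (a i)) (Matrix.of fun i j => w (a i) j)

lemma Matrix.det_sum_cols {ι n : Type*} [Fintype n] [DecidableEq n] [Fintype ι]
    (u : n → ι → n → ℂ) : (Matrix.of fun i j => ∑ r, u j r i).det =
      ∑ r : n → ι, (Matrix.of fun i j => u j (r j) i).det := by
  rw [← Matrix.det_transpose]
  have h := Matrix.det_sum_rows Finset.univ u
  rw [Fintype.piFinset_univ] at h
  refine Eq.trans ?_ (h.trans (Finset.sum_congr rfl fun r _ => ?_))
  · rfl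
  · rw [← Matrix.det_transpose]
    rfl

lemma sum_norm_det_apply_hat_le {k : ℕ} (ℓ : Fin k → CC →L[ℂ] ℂ) (N : ℕ) :
    ∑ a ∈ Fintype.piFinset fun _ : Fin k => Finset.range (N + 1),
      ‖(Matrix.of fun i j => ℓ j (toCC (hat N (a i)))).det‖ ≤ k.factorial * ∏ j, ‖ℓ j‖ := by
  calc _ ≤ ∑ a ∈ Fintype.piFinset fun _ : Fin k => Finset.range (N + 1),
        ∑ σ : Equiv.Perm (Fin k), ∏ i, ‖ℓ (σ i) (toCC (hat N (a i)))‖ := by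
        refine Finset.sum_le_sum fun a _ => ?_
        rw [← Matrix.det_transpose, Matrix.det_apply']
        refine (norm_sum_le _ _).trans (Finset.sum_le_sum fun σ _ => ?_)
        have h6 : ‖((Equiv.Perm.sign σ : ℤ) : ℂ)‖ = 1 := by
          rcases Int.units_eq_one_or (Equiv.Perm.sign σ) with h | h <;> simp [h]
        rw [norm_mul, h6, one_mul, norm_prod]
        rfl
    _ = ∑ σ : Equiv.Perm (Fin k), ∏ i, ∑ b ∈ Finset.range (N + 1), ‖ℓ (σ i) (toCC (hat N b))‖ := by
        rw [Finset.sum_comm]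
        exact Finset.sum_congr rfl fun σ _ => Finset.sum_prod_piFinset (Finset.range (N + 1))
          fun i b => ‖ℓ (σ i) (toCC (hat N b))‖
    _ ≤ ∑ σ : Equiv.Perm (Fin k), ∏ j, ‖ℓ j‖ := by
        refine Finset.sum_le_sum fun σ _ => ?_
        rw [← Equiv.prod_comp σ fun j => ‖ℓ j‖]
        exact Finset.prod_le_prod (fun i _ => by positivity) fun i _ => sum_norm_apply_hat_le _ _
    _ = _ := by simp [Fintype.card_perm]

lemma prod_elim_le_prod {K : ℕ} {ρ : Fin (K + 1) → ℝ} {ρ₀ : ℝ} (h0 : 0 ≤ ρ₀) (hρ : ∀ l, ρ₀ ≤ ρ l)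
    {r : Fin (K + 1) → Option (Fin (K + 1))}
    (hr : ∀ i j l, r i = some l → r j = some l → i = j) :
    ∏ j, (r j).elim ρ₀ ρ ≤ ∏ l, ρ l := by
  obtain ⟨g, hg⟩ := Finset.exists_equiv_extend_of_card_eq (t := Finset.univ)
    (Finset.card_univ (α := Fin (K + 1))).symm
    (s := Finset.univ.filter fun j => r j ≠ none) (f := fun j => (r j).getD 0)
    (Finset.subset_univ _) (by
      intro i hi j hj hij
      simp only [Finset.coe_filter, Finset.mem_univ, true_and, Set.mem_ofPred_eq] at hi hj
      obtain ⟨l, hl⟩ := Option.ne_none_iff_exists'.1 hi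
      obtain ⟨l', hl'⟩ := Option.ne_none_iff_exists'.1 hj
      simp only [hl, hl', Option.getD_some] at hij
      subst hij
      exact hr i j l hl hl')
  set σ : Equiv.Perm (Fin (K + 1)) := g.trans (Equiv.subtypeUnivEquiv fun x => Finset.mem_univ x)
  rw [← Equiv.prod_comp σ ρ]
  refine Finset.prod_le_prod (fun j _ => ?_) fun j _ => ?_
  · cases r j with
    | none => exact h0
    | some l => exact h0.trans (hρ l)
  · cases h : r j with
    | none => exact hρ _
    | some l =>
      have := hg j (by simp [h])
      simp only [h, Option.getD_some] at this
      have h' : σ j = l := this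
      rw [h']
      rfl

lemma exists_sum_norm_det_le {M : CC →L[ℂ] CC} {p : ℕ} (hp : p ≠ 0)
    (hM : IsCompactOperator (M ^ p : CC →L[ℂ] CC)) {Λ : ℕ → ℂ}
    (hΛ : IsMultiplierSeq (M : CC →ₗ[ℂ] CC) Λ) (K : ℕ) {ε : ℝ} (hε : 0 < ε)
    (θ : Fin (K + 1) → I01) : ∃ A, 0 ≤ A ∧ ∀ N n : ℕ,
      ∑ a ∈ Fintype.piFinset fun _ : Fin (K + 1) => Finset.range (N + 1),
        ‖(Matrix.of fun i j => (M ^ n) (toCC (hat N (a i))) (θ j)).det‖ ≤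
      A * (∏ l : Fin (K + 1), (‖Λ l‖ + ε)) ^ n := by
  obtain ⟨C, e, c, R, hC, hdec, hc, hR⟩ := hΛ.exists_decomposition hp hM K hε
  set C' := C * (1 + ∑ l : Fin (K + 1), ‖e l‖) with hC'
  have hC'0 : 0 ≤ C' := by positivity
  set ρ : Fin (K + 1) → ℝ := fun l => ‖Λ l‖ + ε with hρdef
  set ρ₀ : ℝ := ‖Λ K‖ + ε with hρ₀def
  have hρ₀ : 0 ≤ ρ₀ := by positivity
  have hρ : ∀ l, ρ₀ ≤ ρ l := fun l => by
    have := hΛ.antitone (Nat.lt_succ_iff.1 l.2)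
    simp only at this
    simp only [hρdef, hρ₀def]
    linarith
  set ℓ : ℕ → Fin (K + 1) → Option (Fin (K + 1)) → CC →L[ℂ] ℂ := fun n j r =>
    r.elim ((ContinuousMap.evalCLM ℂ (θ j)).comp (R n)) fun l => e l (θ j) • c n l with hℓ
  have heval : ∀ (f : CC) (j : Fin (K + 1)), ‖f (θ j)‖ ≤ ‖f‖ := fun f j => f.norm_coe_le_norm _
  have hℓn : ∀ n j r, ‖ℓ n j r‖ ≤ C' * (r.elim ρ₀ ρ) ^ n := by
    intro n j r
    cases r with
    | none =>
      refine ContinuousLinearMap.opNorm_le_bound _ (by simp only [Option.elim_none]; positivity)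
        fun x => ?_
      change ‖R n x (θ j)‖ ≤ C' * ρ₀ ^ n * ‖x‖
      refine (heval _ _).trans ((R n).le_of_opNorm_le ((hR n).trans ?_) x)
      refine mul_le_mul_of_nonneg_right ?_ (by positivity)
      rw [hC']
      have : 0 ≤ ∑ l : Fin (K + 1), ‖e l‖ := by positivity
      nlinarith
    | some l =>
      change ‖e l (θ j) • c n l‖ ≤ C' * (‖Λ l‖ + ε) ^ n
      rw [norm_smul]
      have h1 : ‖e l‖ ≤ 1 + ∑ l : Fin (K + 1), ‖e l‖ := by
        have : ‖e l‖ ≤ ∑ l : Fin (K + 1), ‖e l‖ := Finset.single_le_sum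
          (f := fun l : Fin (K + 1) => ‖e l‖) (fun _ _ => norm_nonneg _) (Finset.mem_univ l)
        linarith
      calc _ ≤ (1 + ∑ l : Fin (K + 1), ‖e l‖) * (C * (‖Λ l‖ + ε) ^ n) :=
            mul_le_mul ((heval _ _).trans h1) (hc n l l.2) (norm_nonneg _) (by positivity)
        _ = _ := by rw [hC']; ring
  have hexp : ∀ N n (a : Fin (K + 1) → ℕ),
      (Matrix.of fun i j => (M ^ n) (toCC (hat N (a i))) (θ j)).det =
      ∑ r : Fin (K + 1) → Option (Fin (K + 1)),
        (Matrix.of fun i j => ℓ n j (r j) (toCC (hat N (a i)))).det := by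
    intro N n a
    rw [← Matrix.det_sum_cols fun j r i => ℓ n j r (toCC (hat N (a i)))]
    congr 1
    ext i j
    simp only [Matrix.of_apply, Fintype.sum_option, hdec n, hℓ, Option.elim_none, Option.elim_some]
    rw [add_comm, Finset.sum_range]
    simp [mul_comm]
  have hterm : ∀ N n (r : Fin (K + 1) → Option (Fin (K + 1))),
      ∑ a ∈ Fintype.piFinset fun _ : Fin (K + 1) => Finset.range (N + 1),
        ‖(Matrix.of fun i j => ℓ n j (r j) (toCC (hat N (a i)))).det‖ ≤
      (K + 1).factorial * (C' ^ (K + 1) * (∏ l, ρ l) ^ n) := by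
    intro N n r
    have hρ0 : 0 ≤ ∏ l, ρ l := Finset.prod_nonneg fun l _ => hρ₀.trans (hρ l)
    by_cases hr : ∀ i j l, r i = some l → r j = some l → i = j
    · refine (sum_norm_det_apply_hat_le _ N).trans (mul_le_mul_of_nonneg_left ?_ (by positivity))
      calc ∏ j, ‖ℓ n j (r j)‖ ≤ ∏ j, (C' * ((r j).elim ρ₀ ρ) ^ n) :=
            Finset.prod_le_prod (fun _ _ => by positivity) fun j _ => hℓn n j (r j)
        _ = C' ^ (K + 1) * (∏ j, (r j).elim ρ₀ ρ) ^ n := by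
            rw [Finset.prod_mul_distrib, Finset.prod_pow]
            simp
        _ ≤ _ := by
            refine mul_le_mul_of_nonneg_left (pow_le_pow_left₀ (Finset.prod_nonneg fun j _ => ?_)
              (prod_elim_le_prod hρ₀ hρ hr) n) (by positivity)
            cases r j with
            | none => exact hρ₀
            | some l => exact hρ₀.trans (hρ l)
    · push Not at hr
      obtain ⟨i, j, l, hi, hj, hij⟩ := hr
      rw [Finset.sum_eq_zero fun a _ => ?_]
      · positivity
      · rw [norm_eq_zero]
        set v : Fin (K + 1) → ℂ := fun s => if s = i ∨ s = j then e l (θ s) else 1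
        set B : Matrix (Fin (K + 1)) (Fin (K + 1)) ℂ := Matrix.of fun t s =>
          if s = i ∨ s = j then c n l (toCC (hat N (a t))) else ℓ n s (r s) (toCC (hat N (a t)))
        have hB : B.det = 0 := Matrix.det_zero_of_column_eq hij fun t => by simp [B]
        have hvB : (Matrix.of fun t s => ℓ n s (r s) (toCC (hat N (a t)))) =
            Matrix.of fun t s => v s * B t s := by
          ext t s
          by_cases hs : s = i ∨ s = j
          · have hrs : r s = some l := by rcases hs with rfl | rfl <;> assumption
            simp [v, B, hs, hrs, hℓ]
          · simp [v, B, hs]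
        rw [hvB, Matrix.det_mul_row, hB, mul_zero]
  refine ⟨Fintype.card (Fin (K + 1) → Option (Fin (K + 1))) * ((K + 1).factorial * C' ^ (K + 1)),
    by positivity, fun N n => ?_⟩
  calc _ ≤ ∑ a ∈ Fintype.piFinset fun _ : Fin (K + 1) => Finset.range (N + 1),
        ∑ r : Fin (K + 1) → Option (Fin (K + 1)),
          ‖(Matrix.of fun i j => ℓ n j (r j) (toCC (hat N (a i)))).det‖ :=
        Finset.sum_le_sum fun a _ => by
          rw [hexp]
          exact norm_sum_le _ _
    _ ≤ ∑ r : Fin (K + 1) → Option (Fin (K + 1)),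
          ((K + 1).factorial * (C' ^ (K + 1) * (∏ l, ρ l) ^ n)) := by
        rw [Finset.sum_comm]
        exact Finset.sum_le_sum fun r _ => hterm N n r
    _ = _ := by
        rw [Finset.sum_const, Finset.card_univ, nsmul_eq_mul]
        ring

lemma norm_det_pow_apply_le {T : CC →L[ℂ] CC} {k : ℕ} (g : Fin k → CC) (θ : Fin k → I01) (n : ℕ)
    {A : ℝ} (hA : ∀ N : ℕ, ∑ a ∈ Fintype.piFinset fun _ : Fin k => Finset.range (N + 1),
      ‖(Matrix.of fun i j => (T ^ n) (toCC (hat N (a i))) (θ j)).det‖ ≤ A) :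
    ‖(Matrix.of fun i j => (T ^ n) (g i) (θ j)).det‖ ≤ (∏ i, ‖g i‖) * A := by
  have hlim : Tendsto (fun N : ℕ => ‖(Matrix.of fun i j => (T ^ n) (∑ a ∈ Finset.range (N + 1),
      g i (node N a) • toCC (hat N a)) (θ j)).det‖) atTop
      (𝓝 ‖(Matrix.of fun i j => (T ^ n) (g i) (θ j)).det‖) := by
    have hcont : Continuous fun G : Fin k → CC =>
        ‖(Matrix.of fun i j => (T ^ n) (G i) (θ j)).det‖ := by
      refine continuous_norm.comp (Continuous.matrix_det (continuous_matrix fun i j => ?_))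
      exact (ContinuousMap.evalCLM ℂ (θ j)).continuous.comp
        ((T ^ n).continuous.comp (continuous_apply i))
    exact (hcont.tendsto g).comp (tendsto_pi_nhds.2 fun i => tendsto_interpolation (g i))
  refine le_of_tendsto' hlim fun N => ?_
  have h1 : (Matrix.of fun i j => (T ^ n) (∑ a ∈ Finset.range (N + 1),
      g i (node N a) • toCC (hat N a)) (θ j)).det =
      ∑ a ∈ Fintype.piFinset fun _ : Fin k => Finset.range (N + 1),
        (∏ i, g i (node N (a i))) *
          (Matrix.of fun i j => (T ^ n) (toCC (hat N (a i))) (θ j)).det := by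
    rw [← Matrix.det_sum_mul_rows (Finset.range (N + 1)) (fun i a => g i (node N a))
      fun a j => (T ^ n) (toCC (hat N a)) (θ j)]
    congr 1
    ext i j
    simp
  rw [h1]
  refine (norm_sum_le _ _).trans ?_
  refine le_trans ?_ (mul_le_mul_of_nonneg_left (hA N) (by positivity))
  rw [Finset.mul_sum]
  refine Finset.sum_le_sum fun a _ => ?_
  rw [norm_mul, norm_prod]
  exact mul_le_mul_of_nonneg_right (Finset.prod_le_prod (fun _ _ => norm_nonneg _)
    fun i _ => (g i).norm_coe_le_norm _) (norm_nonneg _)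

lemma exists_monotone_det_ne_zero {k : ℕ} {g : Fin k → CC} (hg : LinearIndependent ℂ g) :
    ∃ θ : Fin k → I01, Monotone θ ∧ (Matrix.of fun i j => g i (θ j)).det ≠ 0 := by
  set s : Set (Fin k → ℂ) := Set.range fun (θ : I01) i => g i θ
  have hspan : ⊤ ≤ Submodule.span ℂ s := by
    by_contra h
    obtain ⟨f, hf, hle⟩ := Submodule.exists_le_ker_of_lt_top _ (lt_top_iff_ne_top.2 fun h' => h h'.ge)
    apply hf
    have hlin := Fintype.linearIndependent_iff.1 hg (fun i => f (Pi.single i 1)) (by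
      ext θ
      have h1 : f (fun i => g i θ) = 0 := hle (Submodule.subset_span ⟨θ, rfl⟩)
      rw [LinearMap.pi_apply_eq_sum_univ f] at h1
      simp only [ContinuousMap.coe_sum, ContinuousMap.coe_smul, Finset.sum_apply, Pi.smul_apply,
        smul_eq_mul, ContinuousMap.coe_zero, Pi.zero_apply]
      rw [← h1]
      refine Finset.sum_congr rfl fun i _ => ?_
      rw [smul_eq_mul, mul_comm]
      congr 2
      ext j
      simp [Pi.single_apply, eq_comm])
    ext i
    simpa using hlin i
  set b := Module.Basis.ofSpan hspan
  have : Fintype ((linearIndepOn_empty ℂ id).extend (Set.empty_subset s)) :=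
    FiniteDimensional.fintypeBasisIndex b
  have hcard := (Module.finrank_eq_card_basis b).symm.trans (Module.finrank_fin_fun ℂ)
  set b' := b.reindex (Fintype.equivFinOfCardEq hcard)
  have hmem : ∀ j, ∃ θ : I01, (fun i => g i θ) = b' j := fun j => by
    have : b' j ∈ Set.range b := by
      rw [Module.Basis.reindex_apply]
      exact ⟨_, rfl⟩
    exact Module.Basis.ofSpan_subset hspan this
  choose θ hθ using hmem
  have hdet : (Matrix.of fun i j => g i (θ j)).det ≠ 0 := by
    rw [← Matrix.det_transpose]
    have h1 : LinearIndependent ℂ (Matrix.of fun i j => g i (θ j)).transpose.row := by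
      have h : (Matrix.of fun i j => g i (θ j)).transpose.row = b' := funext hθ
      rw [h]
      exact b'.linearIndependent
    exact ((Matrix.isUnit_iff_isUnit_det _).1
      (Matrix.linearIndependent_rows_iff_isUnit.1 h1)).ne_zero
  refine ⟨θ ∘ Tuple.sort θ, Tuple.monotone_sort θ, ?_⟩
  have h2 := Matrix.det_permute' (Tuple.sort θ) (Matrix.of fun i j => g i (θ j))
  have h3 : (Matrix.of fun i j => g i ((θ ∘ Tuple.sort θ) j)) =
    (Matrix.of fun i j => g i (θ j)).submatrix id (Tuple.sort θ) := rfl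
  rw [h3, h2]
  refine mul_ne_zero ?_ hdet
  rcases Int.units_eq_one_or (Equiv.Perm.sign (Tuple.sort θ)) with h | h <;> simp [h]

lemma det_eq_prod_mul_det {V : Type*} [AddCommGroup V] [Module ℂ V] {N : ℕ} {φ ψ : ℕ → V} {μ : ℕ → ℂ}
    (h : ∀ i < N, ψ i - μ i • φ i ∈ flagSpan ℂ φ i) (ev : Fin N → V →ₗ[ℂ] ℂ) :
    (Matrix.of fun i j : Fin N => ev j (ψ i)).det =
      (∏ i : Fin N, μ i) * (Matrix.of fun i j : Fin N => ev j (φ i)).det := by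
  have hc : ∀ i : Fin N, ∃ c : ℕ → ℂ, ψ i = ∑ l ∈ Finset.range i, c l • φ l + μ i • φ i := by
    intro i
    have h1 := h i i.2
    rw [flagSpan, ← Finset.coe_range, Submodule.mem_span_image_finset_iff_exists_fun] at h1
    obtain ⟨c, hc⟩ := h1
    refine ⟨fun l => if hl : l ∈ Finset.range i then c ⟨l, hl⟩ else 0, ?_⟩
    rw [← sub_eq_iff_eq_add, ← hc]
    refine Eq.trans (Finset.sum_congr rfl fun l _ => ?_) (Finset.sum_coe_sort (Finset.range i)
      fun l => (if hl : l ∈ Finset.range i then c ⟨l, hl⟩ else 0) • φ l)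
    rw [dif_pos l.2]
  choose c hc using hc
  set L : Matrix (Fin N) (Fin N) ℂ := Matrix.of fun i l =>
    if l < i then c i l else if l = i then μ i else 0
  have hL : L.det = ∏ i : Fin N, μ i := by
    rw [Matrix.det_of_isLowerTriangular]
    · simp [L]
    · intro i j hij
      have hij : i < j := hij
      simp [L, hij.not_gt, hij.ne']
  rw [← hL, ← Matrix.det_mul]
  congr 1
  ext i j
  rw [Matrix.of_apply, hc i, Matrix.mul_apply]
  have h2 : ∀ l : Fin N, L i l * (Matrix.of fun i j : Fin N => ev j (φ i)) l j =
      (fun l : ℕ => (if l < i then c i l else if l = i then μ i else 0) * ev j (φ l)) l := fun l => by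
    simp only [L, Matrix.of_apply, Fin.lt_def, Fin.ext_iff]
  rw [Finset.sum_congr rfl fun l _ => h2 l, Fin.sum_univ_eq_sum_range (fun l : ℕ =>
    (if l < i then c i l else if l = i then μ i else 0) * ev j (φ l))]
  rw [← Finset.sum_subset (Finset.range_subset_range.2 i.2), Finset.sum_range_succ]
  · simp only [lt_irrefl, if_false, if_true, map_add, map_sum, map_smul, smul_eq_mul]
    congr 1
    exact Finset.sum_congr rfl fun l hl => by rw [if_pos (Finset.mem_range.1 hl)]
  · intro l _ hl
    rw [Finset.mem_range, not_lt] at hl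
    have : (i : ℕ) < l := hl
    simp [this.not_gt, this.ne']

lemma pow_apply_sub_smul_mem {V : Type*} [AddCommGroup V] [Module ℂ V] {f : Module.End ℂ V}
    {E : Submodule ℂ V} (hE : ∀ x ∈ E, f x ∈ E) {x : V} {ν : ℂ} (hx : f x - ν • x ∈ E) (n : ℕ) :
    (f ^ n) x - ν ^ n • x ∈ E := by
  have := pow_sub_smul_mem (μ := 0) hE hx n
  rwa [zero_smul, sub_zero, sub_zero] at this

lemma IsRootFlag.det_pow_apply {T : CC →L[ℂ] CC} {Λ : ℕ → ℂ} {φ : ℕ → CC} {k : ℕ}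
    (h : IsRootFlag (T : CC →ₗ[ℂ] CC) Λ φ k) (θ : Fin k → I01) (n : ℕ) :
    (Matrix.of fun i j : Fin k => (T ^ n) (φ i) (θ j)).det =
      (∏ i : Fin k, Λ i) ^ n * (Matrix.of fun i j : Fin k => φ i (θ j)).det := by
  have h1 := det_eq_prod_mul_det (N := k) (φ := φ) (ψ := fun i => (T ^ n) (φ i))
    (μ := fun i => Λ i ^ n) (fun i hi => by
      have := pow_apply_sub_smul_mem (fun x hx => (h.mono hi.le).map_mem hx) (h i hi).2.1 n
      rw [← ContinuousLinearMap.toLinearMap_pow] at this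
      exact this)
    (fun j => (ContinuousMap.evalCLM ℂ (θ j) : CC →L[ℂ] ℂ))
  rw [Finset.prod_pow] at h1
  exact h1

end DeterminantBounds

section Comparison

open Filter Topology

lemma genEig_eq_maxGenEigenspace (M : CC →L[ℂ] CC) (μ : ℂ) :
    genEig M μ = Module.End.maxGenEigenspace (M : CC →ₗ[ℂ] CC) μ := by
  have h : ∀ n : ℕ, (((M - μ • (1 : CC →L[ℂ] CC)) ^ n : CC →L[ℂ] CC) : CC →ₗ[ℂ] CC) =
      ((M : Module.End ℂ CC) - μ • (1 : Module.End ℂ CC)) ^ n := fun n => by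
    rw [ContinuousLinearMap.toLinearMap_pow]
    rfl
  have hmono : Monotone fun n : ℕ =>
      LinearMap.ker (((M : Module.End ℂ CC) - μ • (1 : Module.End ℂ CC)) ^ n) := by
    refine monotone_nat_of_le_succ fun n x hx => ?_
    rw [LinearMap.mem_ker] at hx ⊢
    rw [pow_succ', Module.End.mul_apply, hx, map_zero]
  ext x
  rw [genEig, Module.End.mem_maxGenEigenspace]
  simp only [h]
  rw [Submodule.mem_iSup_of_directed _ hmono.directed_le]
  rfl

lemma isFloquetMult_iff (M : CC →L[ℂ] CC) (μ : ℂ) :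
    IsFloquetMult M μ ↔ μ ≠ 0 ∧ Module.End.HasEigenvalue (M : CC →ₗ[ℂ] CC) μ := by
  refine and_congr_right fun _ => ⟨fun ⟨φ, hφ, h⟩ => ?_, fun h => ?_⟩
  · exact Module.End.hasEigenvalue_of_hasEigenvector
      (Module.End.hasEigenvector_iff.2 ⟨Module.End.mem_eigenspace_iff.2 h, hφ⟩)
  · obtain ⟨φ, hφ⟩ := h.exists_hasEigenvector
    exact ⟨φ, hφ.2, hφ.apply_eq_smul⟩

lemma IsOrderedEnumExt.isMultiplierSeq {M : CC →L[ℂ] CC} {Λ : ℕ → ℂ} (h : IsOrderedEnumExt M Λ) :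
    IsMultiplierSeq (M : CC →ₗ[ℂ] CC) fun i => Λ (i + 1) where
  antitone := antitone_nat_of_succ_le fun n => h.1 (n + 1) n.succ_pos
  eq_zero_or i := (h.2.1 (i + 1) i.succ_pos).imp_right fun h => ((isFloquetMult_iff _ _).1 h).2
  card_eq μ hμ hev := by
    rw [← genEig_eq_maxGenEigenspace]
    refine Eq.trans ?_ (h.2.2 μ ((isFloquetMult_iff _ _).2 ⟨hμ, hev⟩))
    refine Nat.card_congr ⟨fun i => ⟨i + 1, Nat.succ_pos _, i.2⟩,
      fun j => ⟨j - 1, ?_⟩, fun i => ?_, fun j => ?_⟩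
    · change Λ (j - 1 + 1) = μ
      rw [Nat.sub_add_cancel j.2.1]
      exact j.2.2
    · exact Subtype.ext (Nat.add_sub_cancel _ _)
    · exact Subtype.ext (Nat.sub_add_cancel j.2.1)

lemma le_of_forall_pow_mul_le {P Q d B : ℝ} (hQ : 0 < Q) (hd : 0 < d)
    (h : ∀ n : ℕ, P ^ n * d ≤ B * Q ^ n) : P ≤ Q := by
  by_contra! hlt
  obtain ⟨n, hn⟩ := pow_unbounded_of_one_lt (B / d) ((one_lt_div hQ).2 hlt)
  rw [div_pow, div_lt_div_iff₀ hd (pow_pos hQ n)] at hn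
  exact (h n).not_gt hn

lemma prod_le_of_forall_pos_le {ι : Type*} [Fintype ι] {P : ℝ} (a : ι → ℝ)
    (h : ∀ ε > 0, P ≤ ∏ i, (a i + ε)) : P ≤ ∏ i, a i := by
  have hc : Continuous fun ε : ℝ => ∏ i, (a i + ε) := by fun_prop
  have ht := (hc.tendsto 0).mono_left (nhdsWithin_le_nhds (s := Set.Ioi 0))
  simp only [add_zero] at ht
  exact ge_of_tendsto ht (eventually_mem_nhdsWithin.mono h)

lemma IsMultiplierSeq.prod_norm_le {α β βh : ℝ → ℝ} (hα : LocallyIntegrable α volume)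
    (hβ : LocallyIntegrable β volume) (hβh : LocallyIntegrable βh volume) {γ : ℝ} (hγ : 0 < γ)
    {K : ℕ} (hsign : ∀ᵐ s ∂volume, 0 ≤ (-1 : ℝ) ^ (K + 1) * βh s ∧
      (-1 : ℝ) ^ (K + 1) * βh s ≤ (-1 : ℝ) ^ (K + 1) * β s)
    {M Mh : CC →L[ℂ] CC} (hM : IsMonodromy α β γ M) (hMh : IsMonodromy α βh γ Mh) {Λ Λh : ℕ → ℂ}
    (hΛ : IsMultiplierSeq (M : CC →ₗ[ℂ] CC) Λ) (hΛh : IsMultiplierSeq (Mh : CC →ₗ[ℂ] CC) Λh) :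
    ∏ i : Fin (K + 1), ‖Λh i‖ ≤ ∏ i : Fin (K + 1), ‖Λ i‖ := by
  by_cases h0 : ∃ i : Fin (K + 1), Λh i = 0
  · obtain ⟨i, hi⟩ := h0
    rw [Finset.prod_eq_zero (Finset.mem_univ i) (by rw [hi, norm_zero])]
    positivity
  push Not at h0
  refine prod_le_of_forall_pos_le _ fun ε hε => ?_
  obtain ⟨p, hp, hcomp⟩ := hM.exists_isCompactOperator_pow hα hβ hγ
  obtain ⟨q, -, hcomph⟩ := hMh.exists_isCompactOperator_pow hα hβh hγ
  obtain ⟨φ, hφ⟩ := hΛh.exists_isRootFlag hcomph (N := K + 1) fun i hi => h0 ⟨i, hi⟩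
  obtain ⟨θ, hθ, hdet⟩ := exists_monotone_det_ne_zero hφ.linearIndependent
  obtain ⟨A, -, hA⟩ := exists_sum_norm_det_le hp hcomp hΛ K hε θ
  refine le_of_forall_pow_mul_le (Finset.prod_pos fun i _ => by positivity) (norm_pos_iff.2 hdet)
    (B := (∏ i : Fin (K + 1), ‖φ i‖) * A) fun n => ?_
  rw [← norm_prod, ← norm_pow, ← norm_mul, ← hφ.det_pow_apply θ n, mul_assoc]
  exact norm_det_pow_apply_le (fun i : Fin (K + 1) => φ i) θ n fun N =>
    (Finset.sum_le_sum fun a _ =>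
      norm_det_pow_apply_hat_le hα hβ hβh hγ.le hsign hM hMh N n a hθ).trans (hA N n)

end Comparison

theorem statement6 (α β βh : ℝ → ℝ)
    (hα : LocallyIntegrable α volume) (hβ : LocallyIntegrable β volume)
    (hβh : LocallyIntegrable βh volume)
    (γ : ℝ) (hγ : 0 < γ)
    (hαper : ∀ᵐ t ∂volume, α (t + γ) = α t) (hβper : ∀ᵐ t ∂volume, β (t + γ) = β t)
    (hβhper : ∀ᵐ t ∂volume, βh (t + γ) = βh t)
    (m : ℤ)
    (hsign : ∀ᵐ t ∂volume,
      0 ≤ (-1 : ℝ) ^ m * βh t ∧ (-1 : ℝ) ^ m * βh t ≤ (-1 : ℝ) ^ m * β t)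
    (M Mh : CC →L[ℂ] CC) (hM : IsMonodromy α β γ M) (hMh : IsMonodromy α βh γ Mh)
    (Λ Λh : ℕ → ℂ) (hΛ : IsOrderedEnumExt M Λ) (hΛh : IsOrderedEnumExt Mh Λh) :
    ∀ k : ℕ, 1 ≤ k → Even ((k : ℤ) - m) →
      ∏ j ∈ Finset.Icc 1 k, ‖Λh j‖ ≤ ∏ j ∈ Finset.Icc 1 k, ‖Λ j‖ := by
  intro k hk hkm
  obtain ⟨K, rfl⟩ := Nat.exists_eq_add_of_le' hk
  have hm : (-1 : ℝ) ^ m = (-1) ^ (K + 1) := by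
    have h1 : (-1 : ℝ) ^ (((K + 1 : ℕ) : ℤ) - m) = 1 := hkm.neg_one_zpow
    rw [zpow_sub₀ (by norm_num), zpow_natCast, div_eq_one_iff_eq (zpow_ne_zero _ (by norm_num))] at h1
    exact h1.symm
  simp only [hm] at hsign
  have hprod : ∀ L : ℕ → ℂ, ∏ j ∈ Finset.Icc 1 (K + 1), ‖L j‖ =
      ∏ i : Fin (K + 1), ‖L (i + 1)‖ := fun L => by
    rw [Fin.prod_univ_eq_prod_range (fun i => ‖L (i + 1)‖), Finset.range_eq_Ico,
      Finset.prod_Ico_add' (fun j => ‖L j‖) 0 (K + 1) 1]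
    rfl
  rw [hprod, hprod]
  exact hΛ.isMultiplierSeq.prod_norm_le hα hβ hβh hγ hsign hM hMh hΛh.isMultiplierSeq
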